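/- arXiv:1808.06898 — 2 statements merged into one kernel-verified Lean document; each statement's English description precedes it below -/
import Mathlib

section
/- Let H be an infinite-dimensional separable complex Hilbert space, let q ∈ (1,∞], let T ∈ B^q(H), and let L be a bounded linear functional on B^q(H). Then the closure of L(O_U(T)) := { L(U† T U) | U a unitary operator on H } is star-shaped with respect to the origin 0 ∈ ℂ. -/
open Filter
open scoped InnerProductSpace ENNReal

/-- The rank-one operator `x ↦ ⟪f, x⟫ • g`. -/
noncomputable def rankOne {H : Type*} [NormedAddCommGroup H] [InnerProductSpace ℂ H]
    (f g : H) : H →L[ℂ] H :=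
  (innerSL ℂ f).smulRight g

/-- The `n`-th singular value (`0`-indexed) of an operator, defined as its distance (in
operator norm) to the operators of rank at most `n`; for compact operators this coincides with
the `(n+1)`-st coefficient of a Schmidt decomposition. -/
noncomputable def sv {H : Type*} [NormedAddCommGroup H] [InnerProductSpace ℂ H]
    (T : H →L[ℂ] H) (n : ℕ) : ℝ :=
  ⨅ (u : Fin n → H) (v : Fin n → H), ‖T - ∑ i, rankOne (u i) (v i)‖

/-- Membership in the `p`-th Schatten class `B^p(H)`, `p ∈ [1,∞]`:  compact and, if `p ≠ ∞`,
`p`-summable singular values. -/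
def MemSchatten {H : Type*} [NormedAddCommGroup H] [InnerProductSpace ℂ H]
    (p : ℝ≥0∞) (T : H →L[ℂ] H) : Prop :=
  IsCompactOperator T ∧ (p ≠ ∞ → Summable fun n => sv T n ^ p.toReal)

/-- The Schatten `p`-norm `ν_p`. -/
noncomputable def schattenNorm {H : Type*} [NormedAddCommGroup H] [InnerProductSpace ℂ H]
    (p : ℝ≥0∞) (T : H →L[ℂ] H) : ℝ :=
  if p = ∞ then ‖T‖ else (∑' n, sv T n ^ p.toReal) ^ (1 / p.toReal)


section
variable {H : Type*} [NormedAddCommGroup H] [InnerProductSpace ℂ H]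

/-- Rank at most `n`. -/
def IsRk (A : H →L[ℂ] H) (n : ℕ) : Prop :=
  ∃ u v : Fin n → H, A = ∑ i, rankOne (u i) (v i)

@[simp] theorem rankOne_apply (f g x : H) : rankOne f g x = ⟪f, x⟫_ℂ • g := by
  simp [rankOne]

theorem rankOne_add_left (f f' g : H) : rankOne (f + f') g = rankOne f g + rankOne f' g := by
  ext x; simp [add_smul]

theorem rankOne_add_right (f g g' : H) : rankOne f (g + g') = rankOne f g + rankOne f g' := by
  ext x; simp

theorem rankOne_smul_left (c : ℂ) (f g : H) :
    rankOne (c • f) g = (starRingEnd ℂ c) • rankOne f g := by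
  ext x; simp [mul_smul, smul_comm (starRingEnd ℂ c)]

theorem rankOne_smul_right (c : ℂ) (f g : H) : rankOne f (c • g) = c • rankOne f g := by
  ext x; simp [smul_comm c]

theorem norm_rankOne_le (f g : H) : ‖rankOne f g‖ ≤ ‖f‖ * ‖g‖ := by
  refine ContinuousLinearMap.opNorm_le_bound _ (by positivity) fun x => ?_
  rw [rankOne_apply, norm_smul]
  calc _ ≤ (‖f‖ * ‖x‖) * ‖g‖ := by gcongr; exact norm_inner_le_norm f x
    _ = _ := by ring

theorem IsRk.zero (n : ℕ) : IsRk (0 : H →L[ℂ] H) n :=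
  ⟨0, 0, by ext x; simp⟩

theorem IsRk.rankOne (f g : H) : IsRk (rankOne f g) 1 :=
  ⟨fun _ => f, fun _ => g, by simp⟩

theorem IsRk.add {A B : H →L[ℂ] H} {n m : ℕ} (hA : IsRk A n) (hB : IsRk B m) :
    IsRk (A + B) (n + m) := by
  obtain ⟨u, v, rfl⟩ := hA
  obtain ⟨u', v', rfl⟩ := hB
  exact ⟨Fin.append u u', Fin.append v v', by simp [Fin.sum_univ_add]⟩

theorem IsRk.mono {A : H →L[ℂ] H} {n m : ℕ} (hA : IsRk A n) (h : n ≤ m) : IsRk A m := by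
  obtain ⟨k, rfl⟩ := Nat.exists_eq_add_of_le h
  simpa using hA.add (IsRk.zero k)

theorem IsRk.smul {A : H →L[ℂ] H} {n : ℕ} (c : ℂ) (hA : IsRk A n) : IsRk (c • A) n := by
  obtain ⟨u, v, rfl⟩ := hA
  exact ⟨u, fun i => c • v i, by simp [rankOne_smul_right, Finset.smul_sum]⟩

theorem IsRk.sum {ι : Type*} (F : Finset ι) (A : ι → H →L[ℂ] H) (h : ∀ i ∈ F, IsRk (A i) 1) :
    IsRk (∑ i ∈ F, A i) F.card := by
  classical
  induction F using Finset.induction_on with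
  | empty => simpa using IsRk.zero 0
  | insert a s ha ih =>
    rw [Finset.sum_insert ha, Finset.card_insert_of_notMem ha, add_comm s.card]
    exact (h a (by simp)).add (ih fun i hi => h i (by simp [hi]))

theorem IsRk.compact {A : H →L[ℂ] H} {n : ℕ} (hA : IsRk A n) : IsCompactOperator A := by
  obtain ⟨u, v, rfl⟩ := hA
  have h1 : ∀ f g : H, IsCompactOperator (_root_.rankOne f g) := by
    intro f g
    have h2 : IsCompactOperator ((ContinuousLinearMap.id ℂ ℂ).smulRight g : ℂ →L[ℂ] H) :=
      isCompactOperator_of_locallyCompactSpace_rng _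
    exact h2.comp_clm (innerSL ℂ f)
  suffices ∀ F : Finset (Fin n), IsCompactOperator (∑ i ∈ F, _root_.rankOne (u i) (v i) : H →L[ℂ] H) from
    this Finset.univ
  intro F
  induction F using Finset.induction_on with
  | empty => simpa using isCompactOperator_zero
  | insert a s ha ih =>
    rw [Finset.sum_insert ha]
    exact (h1 _ _).add ih

theorem sv_nonneg (T : H →L[ℂ] H) (n : ℕ) : 0 ≤ sv T n :=
  Real.iInf_nonneg fun _ => Real.iInf_nonneg fun _ => norm_nonneg _

theorem sv_le (T A : H →L[ℂ] H) (n : ℕ) (hA : IsRk A n) : sv T n ≤ ‖T - A‖ := by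
  obtain ⟨u, v, rfl⟩ := hA
  refine ciInf_le_of_le ⟨0, ?_⟩ u (ciInf_le_of_le ⟨0, ?_⟩ v le_rfl)
  · rintro _ ⟨u, rfl⟩
    exact Real.iInf_nonneg fun _ => norm_nonneg _
  · rintro _ ⟨u, rfl⟩
    exact norm_nonneg _

theorem sv_le_norm (T : H →L[ℂ] H) (n : ℕ) : sv T n ≤ ‖T‖ := by
  simpa using sv_le T 0 n (IsRk.zero n)

theorem exists_of_sv_lt (T : H →L[ℂ] H) (n : ℕ) (a : ℝ) (h : sv T n < a) :
    ∃ A, IsRk A n ∧ ‖T - A‖ < a := by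
  obtain ⟨u, hu⟩ := exists_lt_of_ciInf_lt h
  obtain ⟨v, hv⟩ := exists_lt_of_ciInf_lt hu
  exact ⟨_, ⟨u, v, rfl⟩, hv⟩

theorem sv_antitone (T : H →L[ℂ] H) : Antitone (sv T) := by
  intro n m h
  refine le_of_forall_gt fun a ha => ?_
  obtain ⟨A, hA, h'⟩ := exists_of_sv_lt T n a ha
  exact (sv_le T A m (hA.mono h)).trans_lt h'

theorem sv_eq_zero {A : H →L[ℂ] H} {N n : ℕ} (hA : IsRk A N) (h : N ≤ n) : sv A n = 0 :=
  le_antisymm (by simpa using sv_le A A n (hA.mono h)) (sv_nonneg _ _)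

theorem sv_sub_le (T : H →L[ℂ] H) {F : H →L[ℂ] H} {N : ℕ} (hF : IsRk F N) (m : ℕ) :
    sv (T - F) (m + N) ≤ sv T m := by
  refine le_of_forall_gt fun a ha => ?_
  obtain ⟨A, hA, h'⟩ := exists_of_sv_lt T m a ha
  refine (sv_le (T - F) (A + (-1 : ℂ) • F) (m + N) (hA.add (hF.smul _))).trans_lt ?_
  rwa [show T - F - (A + (-1 : ℂ) • F) = T - A by module]

theorem IsRk.memSchatten {A : H →L[ℂ] H} {N : ℕ} (hA : IsRk A N) {q : ℝ≥0∞} (hq : 1 < q) :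
    MemSchatten q A := by
  refine ⟨hA.compact, fun hq' => ?_⟩
  have : 0 < q.toReal := ENNReal.toReal_pos (by positivity) hq'
  refine summable_of_ne_finset_zero (s := Finset.range N) fun n hn => ?_
  rw [sv_eq_zero hA (by simpa using hn), Real.zero_rpow this.ne']

theorem schattenNorm_nonneg (q : ℝ≥0∞) (A : H →L[ℂ] H) : 0 ≤ schattenNorm q A := by
  unfold schattenNorm
  split_ifs
  · positivity
  · exact Real.rpow_nonneg (tsum_nonneg fun n => Real.rpow_nonneg (sv_nonneg _ _) _) _

theorem IsRk.schattenNorm_le {A : H →L[ℂ] H} {N : ℕ} (hA : IsRk A N) {q : ℝ≥0∞} (hq : 1 < q)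
    {C : ℝ} (hC : ‖A‖ ≤ C) :
    schattenNorm q A ≤ (N : ℝ) ^ (1 / q.toReal) * C := by
  have hC0 : 0 ≤ C := (norm_nonneg _).trans hC
  unfold schattenNorm
  split_ifs with h
  · simpa [h] using hC
  have hp : 0 < q.toReal := ENNReal.toReal_pos (by positivity) h
  rw [tsum_eq_sum (s := Finset.range N)]
  · calc _ ≤ ((N : ℝ) * C ^ q.toReal) ^ (1 / q.toReal) := by
          refine Real.rpow_le_rpow (Finset.sum_nonneg fun n _ => Real.rpow_nonneg (sv_nonneg _ _) _)
            ?_ (by positivity)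
          refine (Finset.sum_le_card_nsmul _ _ (C ^ q.toReal) fun n _ => ?_).trans (by simp)
          exact Real.rpow_le_rpow (sv_nonneg _ _) ((sv_le_norm _ _).trans hC) hp.le
      _ = _ := by
          rw [Real.mul_rpow (by positivity) (by positivity), ← Real.rpow_mul hC0,
            mul_one_div_cancel hp.ne', Real.rpow_one]
  · intro n hn
    rw [sv_eq_zero hA (by simpa using hn), Real.zero_rpow hp.ne']

/-- domination -/
theorem memSchatten_of_sv_le {A B : H →L[ℂ] H} {q : ℝ≥0∞}
    (hA : MemSchatten q A) (hB : IsCompactOperator B) (h : ∀ n, sv B n ≤ sv A n) (h0 : ‖B‖ ≤ ‖A‖) :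
    MemSchatten q B ∧ schattenNorm q B ≤ schattenNorm q A := by
  have key : q ≠ ∞ → Summable fun n => sv B n ^ q.toReal := fun hq' =>
    Summable.of_nonneg_of_le (fun n => Real.rpow_nonneg (sv_nonneg _ _) _)
      (fun n => Real.rpow_le_rpow (sv_nonneg _ _) (h n) ENNReal.toReal_nonneg) (hA.2 hq')
  refine ⟨⟨hB, key⟩, ?_⟩
  unfold schattenNorm
  split_ifs with hq'
  · exact h0
  · refine Real.rpow_le_rpow (tsum_nonneg fun n => Real.rpow_nonneg (sv_nonneg _ _) _) ?_
      (by positivity)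
    exact Summable.tsum_le_tsum
      (fun n => Real.rpow_le_rpow (sv_nonneg _ _) (h n) ENNReal.toReal_nonneg) (key hq') (hA.2 hq')

variable [CompleteSpace H]

theorem conj_rankOne (V W : H →L[ℂ] H) (f g : H) :
    V * rankOne f g * W = rankOne (star W f) (V g) := by
  ext x
  simp [ContinuousLinearMap.star_eq_adjoint, ContinuousLinearMap.adjoint_inner_left]

theorem IsRk.conj {A : H →L[ℂ] H} {n : ℕ} (hA : IsRk A n) (V W : H →L[ℂ] H) :
    IsRk (V * A * W) n := by
  obtain ⟨u, v, rfl⟩ := hA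
  exact ⟨fun i => star W (u i), fun i => V (v i), by
    simp [Finset.mul_sum, Finset.sum_mul, conj_rankOne]⟩

theorem norm_conj_le (A U : H →L[ℂ] H) (hU : ‖U‖ ≤ 1) : ‖star U * A * U‖ ≤ ‖A‖ := by
  have h1 : ‖star U‖ ≤ 1 := by rwa [norm_star]
  calc _ ≤ ‖star U‖ * ‖A‖ * ‖U‖ := (norm_mul_le _ _).trans (by gcongr; exact norm_mul_le _ _)
    _ ≤ 1 * ‖A‖ * 1 := by gcongr
    _ = _ := by ring

theorem sv_conj_le (A U : H →L[ℂ] H) (hU : ‖U‖ ≤ 1) (n : ℕ) : sv (star U * A * U) n ≤ sv A n := by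
  refine le_of_forall_gt fun a ha => ?_
  obtain ⟨B, hB, h'⟩ := exists_of_sv_lt A n a ha
  refine ((sv_le _ _ n (hB.conj (star U) U)).trans ?_).trans_lt h'
  rw [← sub_mul, ← mul_sub]
  exact norm_conj_le _ _ hU

theorem schatten_conj {A U : H →L[ℂ] H} {q : ℝ≥0∞}
    (hA : MemSchatten q A) (hU : ‖U‖ ≤ 1) :
    MemSchatten q (star U * A * U) ∧ schattenNorm q (star U * A * U) ≤ schattenNorm q A := by
  refine memSchatten_of_sv_le hA ?_ (sv_conj_le A U hU) (norm_conj_le A U hU)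
  exact (hA.1.clm_comp (star U)).comp_clm U

end

section
variable {H : Type*} [NormedAddCommGroup H] [InnerProductSpace ℂ H] [CompleteSpace H]

theorem compact_approx {T : H →L[ℂ] H} (hT : IsCompactOperator T) {ε : ℝ} (hε : 0 < ε) :
    ∃ F N, IsRk F N ∧ ‖T - F‖ ≤ ε := by
  obtain ⟨K, hK, hTK⟩ := IsCompactOperator.image_closedBall_subset_compact
    (f := (T : H →ₗ[ℂ] H)) hT 1
  obtain ⟨t, -, htf, ht⟩ := hK.finite_cover_balls hε
  let S : Submodule ℂ H := Submodule.span ℂ t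
  have : FiniteDimensional ℂ S := FiniteDimensional.span_of_finite ℂ htf
  let e := stdOrthonormalBasis ℂ S
  refine ⟨S.starProjection * T, Module.finrank ℂ S, ?_, ?_⟩
  · refine ⟨fun i => star T (e i : H), fun i => (e i : H), ?_⟩
    ext x
    have h := e.sum_repr' (S.orthogonalProjectionOnto (T x))
    have h' := congrArg (Subtype.val) h
    simp only [mul_apply_eq_comp, Submodule.starProjection_apply]
    rw [← h']
    simp [ContinuousLinearMap.star_eq_adjoint, ContinuousLinearMap.adjoint_inner_left]
  · refine ContinuousLinearMap.opNorm_le_of_unit_norm hε.le fun x hx => ?_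
    have hx' : T x ∈ K := hTK ⟨x, by simp [hx], rfl⟩
    obtain ⟨y, hy, hxy⟩ := Set.mem_iUnion₂.1 (ht hx')
    have hyS : y ∈ S := Submodule.subset_span hy
    rw [sub_apply, mul_apply_eq_comp,
      Submodule.starProjection_minimal]
    refine (ciInf_le ⟨0, ?_⟩ (⟨y, hyS⟩ : S)).trans ?_
    · rintro _ ⟨z, rfl⟩; exact norm_nonneg _
    · simpa [dist_eq_norm] using (Metric.mem_ball.1 hxy).le

theorem schatten_approx {q : ℝ≥0∞} (hq : 1 < q) {T : H →L[ℂ] H} (hT : MemSchatten q T)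
    {ε : ℝ} (hε : 0 < ε) :
    ∃ F N, IsRk F N ∧ MemSchatten q (T - F) ∧ schattenNorm q (T - F) ≤ ε := by
  by_cases hq' : q = ∞
  · obtain ⟨F, N, hF, h⟩ := compact_approx hT.1 hε
    exact ⟨F, N, hF, ⟨hT.1.sub hF.compact, fun h => absurd hq' h⟩, by simpa [schattenNorm, hq']⟩
  have hp : 0 < q.toReal := ENNReal.toReal_pos (by positivity) hq'
  set p := q.toReal with hpdef
  have hs : Summable fun n => sv T n ^ p := hT.2 hq'
  set η : ℝ := ε ^ p / 6 with hη
  have hη0 : 0 < η := by positivity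
  have ha0 : ∀ (A : H →L[ℂ] H) n, 0 ≤ sv A n ^ p := fun A n => Real.rpow_nonneg (sv_nonneg _ _) _
  obtain ⟨N, hN⟩ : ∃ N, ∑' k, sv T (k + N) ^ p < η :=
    ((tendsto_sum_nat_add (fun n => sv T n ^ p)).eventually (gt_mem_nhds hη0)).exists
  have hanti : ∀ n m, n ≤ m → sv T m ^ p ≤ sv T n ^ p := fun n m h =>
    Real.rpow_le_rpow (sv_nonneg _ _) (sv_antitone T h) hp.le
  have hsN : Summable fun n => sv T (n + N) ^ p :=
    (summable_nat_add_iff (f := fun n => sv T n ^ p) N).2 hs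
  have h1 : N * sv T (2 * N) ^ p ≤ η := by
    refine le_trans ?_ ((hsN.sum_le_tsum (Finset.range N) (fun _ _ => ha0 _ _)).trans hN.le)
    have := Finset.card_nsmul_le_sum (Finset.range N) (fun n => sv T (n + N) ^ p)
      (sv T (2 * N) ^ p) (fun n hn => hanti _ _ (by have := Finset.mem_range.1 hn; omega))
    simpa using this
  set K := 2 * N with hKdef
  have hsK : Summable fun n => sv T (n + K) ^ p :=
    (summable_nat_add_iff (f := fun n => sv T n ^ p) K).2 hs
  have h2 : ∑' k, sv T (k + K) ^ p ≤ η :=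
    (hsK.tsum_le_tsum (fun k => hanti _ _ (by omega)) hsN).trans hN.le
  set η' : ℝ := η / (2 * K + 1) with hη'
  have hη'0 : 0 < η' := by positivity
  set d : ℝ := (sv T K ^ p + η') ^ (p⁻¹) with hd
  have hdp : d ^ p = sv T K ^ p + η' := by
    rw [hd, ← Real.rpow_mul (by have := ha0 T K; positivity), inv_mul_cancel₀ hp.ne', Real.rpow_one]
  have hd0 : 0 ≤ d := Real.rpow_nonneg (by have := ha0 T K; positivity) _
  have hdl : sv T K < d := by
    rw [← Real.rpow_lt_rpow_iff (sv_nonneg _ _) hd0 hp, hdp]; linarith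
  obtain ⟨F, hF, hFd⟩ := exists_of_sv_lt T K d hdl
  have hb1 : ∀ n, sv (T - F) n ^ p ≤ d ^ p := fun n =>
    Real.rpow_le_rpow (sv_nonneg _ _) ((sv_le_norm _ _).trans hFd.le) hp.le
  have hb2 : ∀ n, sv (T - F) (n + K) ^ p ≤ sv T n ^ p := fun n =>
    Real.rpow_le_rpow (sv_nonneg _ _) (sv_sub_le T hF n) hp.le
  have hsb : Summable fun n => sv (T - F) n ^ p :=
    (summable_nat_add_iff K).1 (Summable.of_nonneg_of_le (fun n => ha0 _ _) hb2 hs)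
  refine ⟨F, K, hF, ⟨hT.1.sub hF.compact, fun _ => hsb⟩, ?_⟩
  have hmain : ∑' n, sv (T - F) n ^ p ≤ ε ^ p := by
    rw [← hsb.sum_add_tsum_nat_add (2 * K)]
    have e1 : ∑ n ∈ Finset.range (2 * K), sv (T - F) n ^ p ≤ 2 * K * d ^ p := by
      have := Finset.sum_le_card_nsmul (Finset.range (2 * K)) (fun n => sv (T - F) n ^ p)
        (d ^ p) (fun n _ => hb1 n)
      simpa using this
    have e2 : ∑' n, sv (T - F) (n + 2 * K) ^ p ≤ η := by
      refine (Summable.tsum_le_tsum (fun n => ?_) ?_ hsK).trans h2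
      · have := hb2 (n + K)
        rwa [show n + K + K = n + 2 * K by ring] at this
      · exact (summable_nat_add_iff (f := fun n => sv (T - F) n ^ p) (2 * K)).2 hsb
    have e3 : 2 * K * η' ≤ η := by
      rw [hη', mul_div_assoc', div_le_iff₀ (by positivity)]
      nlinarith
    have e4 : (K : ℝ) = 2 * N := by simp [hKdef]
    have e5 : 2 * (K : ℝ) * d ^ p ≤ 5 * η := by
      rw [hdp, mul_add]
      have : 2 * (K : ℝ) * sv T K ^ p = 4 * (N * sv T K ^ p) := by rw [e4]; ring
      linarith
    have : ε ^ p = 6 * η := by rw [hη]; ring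
    linarith
  simp only [schattenNorm, hq', if_false, ← hpdef]
  calc _ ≤ (ε ^ p) ^ (1 / p) := Real.rpow_le_rpow (tsum_nonneg fun n => ha0 _ _) hmain (by positivity)
    _ = ε := by rw [← Real.rpow_mul hε.le, mul_one_div_cancel hp.ne', Real.rpow_one]

end

section
variable {H : Type*} [NormedAddCommGroup H] [InnerProductSpace ℂ H]

theorem tendsto_zero_of_sum_bound (z : ℕ → ℂ) (C r : ℝ) (hr : r < 1)
    (h : ∀ (F : Finset ℕ) (l : ℕ → ℂ), (∀ n, ‖l n‖ ≤ 1) →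
      ‖∑ n ∈ F, l n * z n‖ ≤ C * (F.card : ℝ) ^ r) :
    Tendsto z atTop (nhds 0) := by
  by_contra hcon
  rw [Metric.tendsto_atTop] at hcon
  push Not at hcon
  obtain ⟨ε, hε, hcon⟩ := hcon
  have hinf : {n | ε ≤ ‖z n‖}.Infinite := by
    refine Set.infinite_of_not_bddAbove ?_
    rintro ⟨B, hB⟩
    obtain ⟨n, hn, h'⟩ := hcon (B + 1)
    have := hB (show n ∈ {n | ε ≤ ‖z n‖} by simpa using h')
    omega
  have key : ∀ N : ℕ, 0 < N → (N : ℝ) ^ (1 - r) ≤ C / ε := by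
    intro N hN
    obtain ⟨F, hF, hcard⟩ := hinf.exists_subset_card_eq N
    have h1 := h F (fun n => starRingEnd ℂ (z n) / ‖z n‖) (fun n => by
      rw [norm_div]; simp [div_self_le_one])
    have h2 : ∑ n ∈ F, (starRingEnd ℂ (z n) / ‖z n‖) * z n = ((∑ n ∈ F, ‖z n‖ : ℝ) : ℂ) := by
      push_cast
      refine Finset.sum_congr rfl fun n hn => ?_
      have h0 : (‖z n‖ : ℂ) ≠ 0 := by
        have : 0 < ‖z n‖ := hε.trans_le (hF hn)
        exact_mod_cast this.ne'
      rw [div_mul_eq_mul_div, mul_comm, Complex.mul_conj, Complex.normSq_eq_norm_sq]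
      field_simp
      push_cast; ring
    rw [h2, Complex.norm_real, Real.norm_of_nonneg (Finset.sum_nonneg fun _ _ => norm_nonneg _),
      hcard] at h1
    have h3 := Finset.card_nsmul_le_sum F (fun n => ‖z n‖) ε (fun n hn => hF hn)
    rw [hcard, nsmul_eq_mul] at h3
    have hN' : (0 : ℝ) < N := by exact_mod_cast hN
    rw [Real.rpow_sub hN', Real.rpow_one, div_le_div_iff₀ (by positivity) hε]
    linarith
  have ht : Tendsto (fun N : ℕ => (N : ℝ) ^ (1 - r)) atTop atTop :=
    (tendsto_rpow_atTop (by linarith)).comp tendsto_natCast_atTop_atTop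
  obtain ⟨N, hN, hN0⟩ := ((ht.eventually (eventually_gt_atTop (C / ε))).and
    (eventually_gt_atTop 0)).exists
  exact absurd (key N hN0) (not_le.2 hN)

theorem tendsto_of_basis (b : HilbertBasis ℕ ℂ H) (φ : ℕ → H → ℂ) (C : ℝ) (hC : 0 ≤ C)
    (hadd : ∀ n x y, φ n (x + y) = φ n x + φ n y)
    (hsmul : ∀ n (c : ℂ) x, ‖φ n (c • x)‖ = ‖c‖ * ‖φ n x‖)
    (hbd : ∀ n x, ‖φ n x‖ ≤ C * ‖x‖)
    (hb : ∀ i, Tendsto (fun n => φ n (b i)) atTop (nhds 0)) (x : H) :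
    Tendsto (fun n => φ n x) atTop (nhds 0) := by
  have hspan : ∀ y ∈ Submodule.span ℂ (Set.range b),
      Tendsto (fun n => φ n y) atTop (nhds 0) := by
    intro y hy
    induction hy using Submodule.span_induction with
    | mem y hy => obtain ⟨i, rfl⟩ := hy; exact hb i
    | zero =>
      have : ∀ n, φ n 0 = 0 := fun n => by simpa using hbd n 0
      simp [this]
    | add y z _ _ hy hz => simpa [hadd] using hy.add hz
    | smul c y _ hy =>
      rw [tendsto_zero_iff_norm_tendsto_zero] at hy ⊢
      simpa [hsmul] using hy.const_mul ‖c‖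
  rw [Metric.tendsto_atTop]
  intro ε hε
  have hx : x ∈ closure (Submodule.span ℂ (Set.range b) : Set H) := by
    have := b.dense_span
    rw [← Submodule.topologicalClosure_coe, this]; trivial
  obtain ⟨y, hy, hxy⟩ := Metric.mem_closure_iff.1 hx (ε / (2 * (C + 1))) (by positivity)
  obtain ⟨N, hN⟩ := Metric.tendsto_atTop.1 (hspan y hy) (ε / 2) (by positivity)
  refine ⟨N, fun n hn => ?_⟩
  have h1 := hN n hn
  rw [dist_zero_right] at h1 ⊢
  have h2 : φ n x = φ n y + φ n (x - y) := by rw [← hadd]; congr 1; abel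
  have h3 : ‖φ n (x - y)‖ ≤ ε / 2 := by
    refine (hbd n _).trans ?_
    rw [dist_eq_norm] at hxy
    calc C * ‖x - y‖ ≤ (C + 1) * (ε / (2 * (C + 1))) := by gcongr; linarith
      _ = ε / 2 := by field_simp
  rw [h2]
  exact (norm_add_le _ _).trans_lt (by linarith)

/-- Bounded linear functionals on the Schatten class. -/
structure GoodL (q : ℝ≥0∞) (L : (H →L[ℂ] H) → ℂ) (M : ℝ) : Prop where
  q_gt : 1 < q
  map_add : ∀ A B, MemSchatten q A → MemSchatten q B → L (A + B) = L A + L B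
  map_smul : ∀ (c : ℂ) A, MemSchatten q A → L (c • A) = c * L A
  nonneg : 0 ≤ M
  bdd : ∀ A, MemSchatten q A → ‖L A‖ ≤ M * schattenNorm q A

namespace GoodL
variable {q : ℝ≥0∞} {L : (H →L[ℂ] H) → ℂ} {M : ℝ}

theorem mem_rankOne (h : GoodL q L M) (f g : H) : MemSchatten q (rankOne f g) :=
  (IsRk.rankOne f g).memSchatten h.q_gt

theorem rankOne_bdd (h : GoodL q L M) (f g : H) : ‖L (rankOne f g)‖ ≤ M * (‖f‖ * ‖g‖) := by
  refine (h.bdd _ (h.mem_rankOne f g)).trans (mul_le_mul_of_nonneg_left ?_ h.nonneg)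
  simpa using (IsRk.rankOne f g).schattenNorm_le h.q_gt (norm_rankOne_le f g)

theorem sum_eq (h : GoodL q L M) {ι : Type*} (F : Finset ι) (l : ι → ℂ) (u v : ι → H) :
    L (∑ n ∈ F, l n • rankOne (u n) (v n)) = ∑ n ∈ F, l n * L (rankOne (u n) (v n)) := by
  classical
  induction F using Finset.induction_on with
  | empty =>
    have := h.map_smul 0 0 ((IsRk.zero 0).memSchatten h.q_gt)
    simpa using this
  | insert a s ha ih =>
    rw [Finset.sum_insert ha, Finset.sum_insert ha, h.map_add _ _
      (((IsRk.rankOne _ _).smul _).memSchatten h.q_gt)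
      ((IsRk.sum s _ fun i _ => (IsRk.rankOne _ _).smul _).memSchatten h.q_gt), ih,
      h.map_smul _ _ (h.mem_rankOne _ _)]

theorem one_div_lt (h : GoodL q L M) : 1 / q.toReal < 1 := by
  by_cases hq : q = ∞
  · simp [hq]
  · have : 1 < q.toReal := by
      have := (ENNReal.toReal_lt_toReal (by simp) hq).2 h.q_gt
      simpa using this
    rw [div_lt_one (by linarith)]; exact this

theorem norm_sq_sum {v : ℕ → H} (hv : Orthonormal ℂ v) (l : ℕ → ℂ) (F : Finset ℕ) :
    ‖∑ n ∈ F, l n • v n‖ ^ 2 = ∑ n ∈ F, ‖l n‖ ^ 2 := by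
  have h := hv.inner_sum l l F
  rw [inner_self_eq_norm_sq_to_K] at h
  have h2 : ∀ n, starRingEnd ℂ (l n) * l n = ((‖l n‖ ^ 2 : ℝ) : ℂ) := fun n => by
    rw [mul_comm, Complex.mul_conj, Complex.normSq_eq_norm_sq]
  simp only [h2] at h
  refine Complex.ofReal_injective ?_
  push_cast at h ⊢
  exact h

/-- diagonal-type decay -/
theorem tendsto_diag (h : GoodL q L M) {u v : ℕ → H} (hu : Orthonormal ℂ u)
    (hv : Orthonormal ℂ v) : Tendsto (fun n => L (rankOne (u n) (v n))) atTop (nhds 0) := by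
  refine tendsto_zero_of_sum_bound _ M (1 / q.toReal) h.one_div_lt fun F l hl => ?_
  rw [← h.sum_eq]
  have hrk : IsRk (∑ n ∈ F, l n • rankOne (u n) (v n)) F.card :=
    IsRk.sum F _ fun i _ => (IsRk.rankOne _ _).smul _
  refine (h.bdd _ (hrk.memSchatten h.q_gt)).trans (mul_le_mul_of_nonneg_left ?_ h.nonneg)
  have hn : ‖∑ n ∈ F, l n • rankOne (u n) (v n)‖ ≤ 1 := by
    refine ContinuousLinearMap.opNorm_le_bound _ zero_le_one fun x => ?_
    have e : (∑ n ∈ F, l n • rankOne (u n) (v n)) x = ∑ n ∈ F, (l n * ⟪u n, x⟫_ℂ) • v n := by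
      simp [mul_smul]
    rw [e, one_mul]
    refine le_of_sq_le_sq ?_ (norm_nonneg _)
    rw [norm_sq_sum hv]
    refine le_trans (Finset.sum_le_sum fun n _ => ?_) (hu.sum_inner_products_le x (s := F))
    rw [norm_mul, mul_pow]
    have := hl n
    exact mul_le_of_le_one_left (by positivity) (pow_le_one₀ (norm_nonneg _) this)
  simpa using hrk.schattenNorm_le h.q_gt hn

theorem norm_sum_le {v : ℕ → H} (hv : Orthonormal ℂ v) (l : ℕ → ℂ) (hl : ∀ n, ‖l n‖ ≤ 1)
    (F : Finset ℕ) : ‖∑ n ∈ F, l n • v n‖ ≤ (F.card : ℝ) ^ (1 / 2 : ℝ) := by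
  rw [← Real.sqrt_eq_rpow]
  refine Real.le_sqrt_of_sq_le ?_
  rw [norm_sq_sum hv]
  refine (Finset.sum_le_card_nsmul _ _ 1 fun n _ => ?_).trans (by simp)
  exact pow_le_one₀ (norm_nonneg _) (hl n)

theorem tendsto_right (h : GoodL q L M) {v : ℕ → H} (hv : Orthonormal ℂ v) (f : H) :
    Tendsto (fun n => L (rankOne f (v n))) atTop (nhds 0) := by
  refine tendsto_zero_of_sum_bound _ (M * ‖f‖) (1 / 2) (by norm_num) fun F l hl => ?_
  rw [← h.sum_eq F l (fun _ => f)]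
  have : ∑ n ∈ F, l n • rankOne f (v n) = rankOne f (∑ n ∈ F, l n • v n) := by
    ext x
    simp only [sum_apply, smul_apply, rankOne_apply, Finset.smul_sum]
    exact Finset.sum_congr rfl fun n _ => smul_comm _ _ _
  rw [this, mul_assoc]
  refine (h.rankOne_bdd _ _).trans ?_
  have := h.nonneg
  gcongr
  exact norm_sum_le hv l hl F

theorem tendsto_left (h : GoodL q L M) {v : ℕ → H} (hv : Orthonormal ℂ v) (g : H) :
    Tendsto (fun n => L (rankOne (v n) g)) atTop (nhds 0) := by
  refine tendsto_zero_of_sum_bound _ (M * ‖g‖) (1 / 2) (by norm_num) fun F l hl => ?_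
  rw [← h.sum_eq F l _ (fun _ => g)]
  have : ∑ n ∈ F, l n • rankOne (v n) g = rankOne (∑ n ∈ F, starRingEnd ℂ (l n) • v n) g := by
    ext x
    simp [Finset.sum_smul, mul_smul]
    exact Finset.sum_congr rfl fun n _ => smul_comm _ _ _
  rw [this, mul_assoc, mul_comm ‖g‖]
  refine (h.rankOne_bdd _ _).trans ?_
  have := h.nonneg
  gcongr
  exact norm_sum_le hv _ (by simpa using hl) F

/-- two-step density -/
theorem tendsto_all (h : GoodL q L M) (b : HilbertBasis ℕ ℂ H) (P Q : ℕ → H →L[ℂ] H)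
    (hP : ∀ n, ‖P n‖ ≤ 1) (hQ : ∀ n, ‖Q n‖ ≤ 1)
    (hb : ∀ i j, Tendsto (fun n => L (rankOne (P n (b i)) (Q n (b j)))) atTop (nhds 0)) (f g : H) :
    Tendsto (fun n => L (rankOne (P n f) (Q n g))) atTop (nhds 0) := by
  have hM := h.nonneg
  have hP' : ∀ n x, ‖P n x‖ ≤ ‖x‖ := fun n x => by
    simpa using (P n).le_of_opNorm_le (hP n) x
  have hQ' : ∀ n x, ‖Q n x‖ ≤ ‖x‖ := fun n x => by
    simpa using (Q n).le_of_opNorm_le (hQ n) x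
  refine tendsto_of_basis b (fun n g => L (rankOne (P n f) (Q n g))) (M * ‖f‖) (by positivity)
    ?_ ?_ ?_ (fun j => ?_) g
  · intro n x y
    simp only [_root_.map_add, rankOne_add_right]
    exact h.map_add _ _ (h.mem_rankOne _ _) (h.mem_rankOne _ _)
  · intro n c x
    simp only [_root_.map_smul, rankOne_smul_right]
    rw [h.map_smul _ _ (h.mem_rankOne _ _), norm_mul]
  · intro n x
    refine (h.rankOne_bdd _ _).trans ?_
    rw [mul_assoc]
    gcongr
    · exact hP' n f
    · exact hQ' n x
  refine tendsto_of_basis b (fun n f => L (rankOne (P n f) (Q n (b j)))) (M * ‖b j‖) (by positivity)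
    ?_ ?_ ?_ (fun i => hb i j) f
  · intro n x y
    simp only [_root_.map_add, rankOne_add_left]
    exact h.map_add _ _ (h.mem_rankOne _ _) (h.mem_rankOne _ _)
  · intro n c x
    simp only [_root_.map_smul, rankOne_smul_left]
    rw [h.map_smul _ _ (h.mem_rankOne _ _), norm_mul]
    simp
  · intro n x
    refine (h.rankOne_bdd _ _).trans ?_
    rw [mul_assoc, mul_comm ‖b j‖]
    gcongr
    · exact hP' n x
    · exact hQ' n (b j)

end GoodL
end

section
variable {H : Type*} [NormedAddCommGroup H] [InnerProductSpace ℂ H] [CompleteSpace H]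

theorem exists_swap_op (b : HilbertBasis ℕ ℂ H) (n : ℕ) :
    ∃ S : H →L[ℂ] H, star S = S ∧ S * S = 1 ∧ ∀ i, S (b i) = b (i ^^^ 2 ^ n) := by
  have hinv : ∀ i, (i ^^^ 2 ^ n) ^^^ 2 ^ n = i := fun i => by simp
  have hinj : Function.Injective fun i : ℕ => i ^^^ 2 ^ n := Function.LeftInverse.injective
    (g := fun i : ℕ => i ^^^ 2 ^ n) hinv
  have ho : Orthonormal ℂ fun i => b (i ^^^ 2 ^ n) := b.orthonormal.comp _ hinj
  have hr : Set.range (fun i => b (i ^^^ 2 ^ n)) = Set.range b := by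
    ext x; constructor
    · rintro ⟨i, rfl⟩; exact ⟨_, rfl⟩
    · rintro ⟨i, rfl⟩; exact ⟨i ^^^ 2 ^ n, by simp only [hinv]⟩
  let b' := HilbertBasis.mk ho (by rw [hr, b.dense_span])
  let e : H ≃ₗᵢ[ℂ] H := b.repr.trans b'.repr.symm
  have he : ∀ i, e (b i) = b (i ^^^ 2 ^ n) := fun i => by
    classical
    have : b' i = b (i ^^^ 2 ^ n) := by simp [b']
    simp only [e, LinearIsometryEquiv.trans_apply]
    rw [b.repr_self, b'.repr_symm_single, this]
  let S : H →L[ℂ] H := (e : H ≃L[ℂ] H)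
  have hS : ∀ i, S (b i) = b (i ^^^ 2 ^ n) := he
  have hSS : S * S = 1 := by
    refine ContinuousLinearMap.ext_on (s := Set.range b) ?_ ?_
    · rw [dense_iff_closure_eq, ← Submodule.topologicalClosure_coe, b.dense_span]; rfl
    · rintro _ ⟨i, rfl⟩
      simp only [mul_apply_eq_comp, hS, hinv]; simp
  have h1 : star S * S = 1 := by
    have : star S = (e.symm : H ≃L[ℂ] H) := e.star_eq_symm
    rw [this]
    ext x
    exact e.symm_apply_apply x
  refine ⟨S, ?_, hSS, hS⟩
  calc star S = star S * (S * S) := by rw [hSS, mul_one]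
    _ = S := by rw [← mul_assoc, h1, one_mul]

namespace GoodL
variable {q : ℝ≥0∞} {L : (H →L[ℂ] H) → ℂ} {M : ℝ}

theorem approx_finite (h : GoodL q L M) (b : HilbertBasis ℕ ℂ H) (t : ℝ) (ht0 : 0 ≤ t)
    (ht1 : t ≤ 1) : ∃ U : ℕ → H →L[ℂ] H, (∀ n, U n ∈ unitary (H →L[ℂ] H)) ∧
      ∀ F N, IsRk F N → Tendsto (fun n => L (star (U n) * F * U n)) atTop (nhds (t * L F)) := by
  choose S hSs hSS hSb using exists_swap_op b
  set s : ℂ := ((√t : ℝ) : ℂ) with hs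
  set c : ℂ := ((√(1 - t) : ℝ) : ℂ) * Complex.I with hc
  have hs2 : s * s = t := by rw [hs, ← Complex.ofReal_mul, Real.mul_self_sqrt ht0]
  have hc2 : c * c = -(1 - t) := by
    rw [hc, mul_mul_mul_comm, ← Complex.ofReal_mul, Real.mul_self_sqrt (by linarith)]
    simp
  have hss : starRingEnd ℂ s = s := Complex.conj_ofReal _
  have hcs : starRingEnd ℂ c = -c := by simp [hc]
  have hSn : ∀ n, ‖S n‖ ≤ 1 := fun n => by
    have := CStarRing.norm_star_mul_self (x := S n)
    rw [hSs, hSS] at this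
    have h1 : ‖(1 : H →L[ℂ] H)‖ ≤ 1 := ContinuousLinearMap.norm_id_le
    nlinarith [norm_nonneg (S n)]
  have h1n : ‖(1 : H →L[ℂ] H)‖ ≤ 1 := ContinuousLinearMap.norm_id_le
  have hU : ∀ n, star (s • (1 : H →L[ℂ] H) + c • S n) = s • 1 - c • S n := fun n => by
    rw [star_add, star_smul, star_smul, star_one, hSs]
    simp only [RCLike.star_def, hss, hcs, neg_smul]; abel
  have ho : ∀ i, Orthonormal ℂ fun n => b (i ^^^ 2 ^ n) := fun i => by
    refine b.orthonormal.comp _ ?_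
    exact (Nat.xor_right_injective (x := i)).comp (Nat.pow_right_injective le_rfl)
  refine ⟨fun n => s • 1 + c • S n, fun n => ?_, fun F N hF => ?_⟩
  · have e1 : (s • (1 : H →L[ℂ] H)  - c • S n) * (s • 1 + c • S n) = 1 := by
      simp only [sub_mul, mul_add, smul_mul_smul, one_mul, mul_one, hSS, hs2, hc2, mul_comm c s]
      module
    have e2 : (s • (1 : H →L[ℂ] H)  + c • S n) * (s • 1 - c • S n) = 1 := by
      simp only [mul_sub, add_mul, smul_mul_smul, one_mul, mul_one, hSS, hs2, hc2, mul_comm c s]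
      module
    rw [Unitary.mem_iff, hU]
    exact ⟨e1, e2⟩
  · obtain ⟨u, v, rfl⟩ := hF
    have hsum : ∀ u v : Fin N → H,
        L (∑ i, rankOne (u i) (v i)) = ∑ i, L (rankOne (u i) (v i)) := fun u v => by
      simpa using h.sum_eq Finset.univ (fun _ => 1) u v
    simp only [Finset.mul_sum, Finset.sum_mul, conj_rankOne, hsum]
    refine tendsto_finsetSum _ fun i _ => ?_
    generalize u i = f
    generalize v i = g
    have l1 := h.tendsto_all b S (fun _ => 1) hSn (fun _ => h1n)
      (fun i j => by simpa [hSb] using h.tendsto_left (ho i) (b j)) f g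
    have l2 := h.tendsto_all b (fun _ => 1) S (fun _ => h1n) hSn
      (fun i j => by simpa [hSb] using h.tendsto_right (ho j) (b i)) f g
    have l3 := h.tendsto_all b S S hSn hSn
      (fun i j => by simpa [hSb] using h.tendsto_diag (ho i) (ho j)) f g
    have heq : ∀ n, L (rankOne (star (s • (1 : H →L[ℂ] H) + c • S n) f)
        (star (s • (1 : H →L[ℂ] H) + c • S n) g)) =
        t * L (rankOne f g) + (s * c) * L (rankOne (S n f) ((1 : H →L[ℂ] H) g))
          + (-(s * c)) * L (rankOne ((1 : H →L[ℂ] H) f) (S n g))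
          + (1 - t) * L (rankOne (S n f) (S n g)) := by
      intro n
      have hop : rankOne (star (s • (1 : H →L[ℂ] H) + c • S n) f)
        (star (s • (1 : H →L[ℂ] H) + c • S n) g) =
          (t : ℂ) • rankOne f g + ((s * c) • rankOne (S n f) g + ((-(s * c)) • rankOne f (S n g)
            + (1 - t : ℂ) • rankOne (S n f) (S n g))) := by
        have : (1 - t : ℂ) = - (c * c) := by rw [hc2]; ring
        rw [hU, this, ← hs2]
        have e : ∀ x : H, (s • (1 : H →L[ℂ] H) - c • S n) x = s • x + (-c) • S n x := fun x => by
          simp [sub_eq_add_neg]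
        rw [e, e]
        simp only [rankOne_add_left, rankOne_add_right, rankOne_smul_left, rankOne_smul_right,
          hss, map_neg, hcs]
        module
      have m1 : ∀ (a : ℂ) (x y : H), IsRk (a • rankOne x y) 1 := fun a x y =>
        (IsRk.rankOne x y).smul a
      rw [hop, h.map_add _ _ ((m1 _ _ _).memSchatten h.q_gt)
        (((m1 _ _ _).add ((m1 _ _ _).add (m1 _ _ _))).memSchatten h.q_gt),
        h.map_add _ _ ((m1 _ _ _).memSchatten h.q_gt)
        (((m1 _ _ _).add (m1 _ _ _)).memSchatten h.q_gt),
        h.map_add _ _ ((m1 _ _ _).memSchatten h.q_gt) ((m1 _ _ _).memSchatten h.q_gt)]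
      simp only [h.map_smul _ _ (h.mem_rankOne _ _), one_apply_eq_self]
      ring
    simp only [heq]
    have := ((tendsto_const_nhds (x := (t : ℂ) * L (rankOne f g))).add (l1.const_mul (s * c))).add
      (l2.const_mul (-(s * c))) |>.add (l3.const_mul (1 - t : ℂ))
    simpa using this

theorem mem_closure (h : GoodL q L M) (b : HilbertBasis ℕ ℂ H) (t : ℝ) (ht0 : 0 ≤ t)
    (ht1 : t ≤ 1) (T : H →L[ℂ] H) (hT : MemSchatten q T) :
    (t * L T : ℂ) ∈ closure {z | ∃ U ∈ unitary (H →L[ℂ] H), z = L (star U * T * U)} := by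
  rw [Metric.mem_closure_iff]
  intro ε hε
  have hM := h.nonneg
  obtain ⟨F, N, hF, hR, hRn⟩ := schatten_approx h.q_gt hT (ε := ε / (4 * (M + 1))) (by positivity)
  obtain ⟨U, hU, hlim⟩ := h.approx_finite b t ht0 ht1
  obtain ⟨n, hn⟩ := (Metric.tendsto_nhds.1 (hlim F N hF) (ε / 4) (by positivity)).exists
  refine ⟨_, ⟨U n, hU n, rfl⟩, ?_⟩
  have hUn : ‖U n‖ ≤ 1 := by
    have := CStarRing.norm_star_mul_self (x := U n)
    rw [(Unitary.mem_iff.1 (hU n)).1] at this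
    have h1 : ‖(1 : H →L[ℂ] H)‖ ≤ 1 := ContinuousLinearMap.norm_id_le
    nlinarith [norm_nonneg (U n)]
  obtain ⟨hR', hRn'⟩ := schatten_conj hR hUn
  have b0 : M * (ε / (4 * (M + 1))) ≤ ε / 4 := by
    calc _ ≤ (M + 1) * (ε / (4 * (M + 1))) := by gcongr; linarith
      _ = _ := by field_simp
  have b1 : ‖L (T - F)‖ ≤ ε / 4 := (h.bdd _ hR).trans ((mul_le_mul_of_nonneg_left hRn hM).trans b0)
  have b2 : ‖L (star (U n) * (T - F) * U n)‖ ≤ ε / 4 :=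
    (h.bdd _ hR').trans ((mul_le_mul_of_nonneg_left (hRn'.trans hRn) hM).trans b0)
  have e1 : L T = L F + L (T - F) := by
    rw [← h.map_add _ _ (hF.memSchatten h.q_gt) hR]; congr 1; abel
  have e2 : L (star (U n) * T * U n) =
      L (star (U n) * F * U n) + L (star (U n) * (T - F) * U n) := by
    rw [← h.map_add _ _ ((hF.conj _ _).memSchatten h.q_gt) hR', ← add_mul, ← mul_add]
    congr 3; abel
  rw [dist_comm, dist_eq_norm]
  rw [dist_eq_norm] at hn
  have e3 : L (star (U n) * T * U n) - t * L T = (L (star (U n) * F * U n) - t * L F)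
      + (L (star (U n) * (T - F) * U n) - t * L (T - F)) := by rw [e1, e2]; ring
  have b3 : ‖(t : ℂ) * L (T - F)‖ ≤ ε / 4 := by
    rw [norm_mul, Complex.norm_real, Real.norm_of_nonneg ht0]
    exact (mul_le_of_le_one_left (norm_nonneg _) ht1).trans b1
  rw [e3]
  have := norm_add_le (L (star (U n) * F * U n) - t * L F)
    (L (star (U n) * (T - F) * U n) - t * L (T - F))
  have := norm_sub_le (L (star (U n) * (T - F) * U n)) (t * L (T - F))
  linarith

end GoodL
end

/-- Let `q ∈ (1,∞]`, `T ∈ B^q(H)` and let `L` be a bounded linear functional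
on `B^q(H)` (encoded as a function which is additive, homogeneous and `ν_q`-bounded on the
`q`-th Schatten class).  Then the closure of `L(O_U(T)) = { L(U† T U) | U unitary }` is
star-shaped with respect to the origin. -/
theorem stmt_12 {H : Type*} [NormedAddCommGroup H] [InnerProductSpace ℂ H] [CompleteSpace H]
    (b : HilbertBasis ℕ ℂ H)  -- `H` is infinite-dimensional and separable
    (q : ℝ≥0∞) (hq : 1 < q)
    (T : H →L[ℂ] H) (hT : MemSchatten q T)
    (L : (H →L[ℂ] H) → ℂ)
    (hL_add : ∀ A B, MemSchatten q A → MemSchatten q B → L (A + B) = L A + L B)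
    (hL_smul : ∀ (c : ℂ) A, MemSchatten q A → L (c • A) = c * L A)
    (hL_bdd : ∃ M : ℝ, ∀ A, MemSchatten q A → ‖L A‖ ≤ M * schattenNorm q A) :
    (0 : ℂ) ∈ closure {z | ∃ U ∈ unitary (H →L[ℂ] H), z = L (star U * T * U)} ∧
      StarConvex ℝ (0 : ℂ)
        (closure {z | ∃ U ∈ unitary (H →L[ℂ] H), z = L (star U * T * U)}) := by
  obtain ⟨M, hM⟩ := hL_bdd
  have h : GoodL q L (max M 0) := ⟨hq, hL_add, hL_smul, le_max_right _ _, fun A hA =>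
    (hM A hA).trans (mul_le_mul_of_nonneg_right (le_max_left _ _) (schattenNorm_nonneg _ _))⟩
  set O := {z | ∃ U ∈ unitary (H →L[ℂ] H), z = L (star U * T * U)} with hO
  have key : ∀ t : ℝ, 0 ≤ t → t ≤ 1 → ∀ z ∈ O, (t * z : ℂ) ∈ closure O := by
    rintro t ht0 ht1 _ ⟨U, hU, rfl⟩
    have hUn : ‖U‖ ≤ 1 := by
      have := CStarRing.norm_star_mul_self (x := U)
      rw [(Unitary.mem_iff.1 hU).1] at this
      have h1 : ‖(1 : H →L[ℂ] H)‖ ≤ 1 := ContinuousLinearMap.norm_id_le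
      nlinarith [norm_nonneg U]
    refine closure_mono ?_ (h.mem_closure b t ht0 ht1 _ (schatten_conj hT hUn).1)
    rintro _ ⟨V, hV, rfl⟩
    exact ⟨U * V, mul_mem hU hV, by simp [mul_assoc]⟩
  refine ⟨?_, ?_⟩
  · simpa using key 0 le_rfl zero_le_one _ ⟨1, one_mem _, rfl⟩
  · rw [starConvex_zero_iff]
    intro x hx a ha0 ha1
    have hc : Continuous fun z : ℂ => (a * z : ℂ) := by fun_prop
    have : (a * x : ℂ) ∈ closure (closure O) :=
      map_mem_closure hc hx (fun z hz => key a ha0 ha1 z hz)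
    rw [closure_closure] at this
    simpa using this
end

section
/- Let H be an infinite-dimensional separable complex Hilbert space, let T ∈ B^1(H) be a trace-class operator, and let L be a bounded linear functional on B^1(H). Then for every z ∈ tr(T)·W_e(L), the closure of L(O_U(T)) := { L(U† T U) | U a unitary operator on H } is star-shaped with respect to z. -/
open Filter
open scoped InnerProductSpace ENNReal

/-- The trace of an operator computed along the orthonormal basis `b`; for trace-class
operators this is basis-independent. -/
noncomputable def traceAlong {H : Type*} [NormedAddCommGroup H] [InnerProductSpace ℂ H]
    [CompleteSpace H] (b : HilbertBasis ℕ ℂ H) (A : H →L[ℂ] H) : ℂ :=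
  ∑' i, ⟪(b i : H), A (b i)⟫_ℂ

/-- The essential range of a functional `L` on a Schatten class: all limits
`lim_n L(⟪f n, ·⟫ f n)` over orthonormal systems `(f n)` in `H`. -/
def essRange {H : Type*} [NormedAddCommGroup H] [InnerProductSpace ℂ H]
    (L : (H →L[ℂ] H) → ℂ) : Set ℂ :=
  {w | ∃ f : ℕ → H, Orthonormal ℂ f ∧
    Tendsto (fun n => L (rankOne (f n) (f n))) atTop (nhds w)}

set_option linter.unusedSectionVars false
set_option linter.unusedSimpArgs false
namespace St13

section
variable {H : Type*} [NormedAddCommGroup H] [InnerProductSpace ℂ H]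

lemma rankOne_apply (f g x : H) : rankOne f g x = ⟪f, x⟫_ℂ • g := rfl

lemma rankOne_zero_right (f : H) : rankOne f (0:H) = 0 := by
  ext x; simp [rankOne_apply]

lemma sv_nonneg (T : H →L[ℂ] H) (n : ℕ) : 0 ≤ sv T n :=
  Real.iInf_nonneg fun _ => Real.iInf_nonneg fun _ => norm_nonneg _

lemma sv_le (T : H →L[ℂ] H) (n : ℕ) (u v : Fin n → H) :
    sv T n ≤ ‖T - ∑ i, rankOne (u i) (v i)‖ := by
  refine (ciInf_le ⟨0, ?_⟩ u).trans (ciInf_le ⟨0, ?_⟩ v)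
  · rintro _ ⟨w, rfl⟩
    exact Real.iInf_nonneg fun _ => norm_nonneg _
  · rintro _ ⟨w, rfl⟩
    exact norm_nonneg _

lemma exists_near (T : H →L[ℂ] H) (n : ℕ) (ε : ℝ) (hε : 0 < ε) :
    ∃ u v : Fin n → H, ‖T - ∑ i, rankOne (u i) (v i)‖ < sv T n + ε := by
  have h : sv T n < sv T n + ε := by linarith
  obtain ⟨u, hu⟩ := exists_lt_of_ciInf_lt h
  obtain ⟨v, hv⟩ := exists_lt_of_ciInf_lt hu
  exact ⟨u, v, hv⟩

/-- rank at most n -/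
def RankLE (N : ℕ) (D : H →L[ℂ] H) : Prop :=
  ∃ u v : Fin N → H, D = ∑ i, rankOne (u i) (v i)

lemma RankLE.add {N M : ℕ} {D E : H →L[ℂ] H} (hD : RankLE N D) (hE : RankLE M E) :
    RankLE (N + M) (D + E) := by
  obtain ⟨u, v, rfl⟩ := hD
  obtain ⟨u', v', rfl⟩ := hE
  refine ⟨Fin.append u u', Fin.append v v', ?_⟩
  simp [Fin.sum_univ_add]

lemma RankLE.neg {N : ℕ} {D : H →L[ℂ] H} (hD : RankLE N D) : RankLE N (-D) := by
  obtain ⟨u, v, rfl⟩ := hD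
  refine ⟨u, fun i => - v i, ?_⟩
  rw [← Finset.sum_neg_distrib]
  refine Finset.sum_congr rfl fun i _ => ?_
  ext x; simp [rankOne_apply]

lemma RankLE.zero (N : ℕ) : RankLE N (0 : H →L[ℂ] H) :=
  ⟨0, 0, by simp [rankOne_zero_right]⟩

lemma sv_le' (T : H →L[ℂ] H) {n : ℕ} {D : H →L[ℂ] H} (hD : RankLE n D) :
    sv T n ≤ ‖T - D‖ := by
  obtain ⟨u, v, rfl⟩ := hD
  exact sv_le T n u v

lemma sv_add_le (T : H →L[ℂ] H) {m : ℕ} {D : H →L[ℂ] H} (hD : RankLE m D) (n : ℕ) :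
    sv (T + D) (n + m) ≤ sv T n := by
  refine le_of_forall_pos_le_add fun ε hε => ?_
  obtain ⟨u, v, h⟩ := exists_near T n ε hε
  have h2 : RankLE n (∑ i, rankOne (u i) (v i)) := ⟨u, v, rfl⟩
  refine (sv_le' (T + D) (h2.add hD)).trans ?_
  rw [add_sub_add_right_eq_sub]
  exact h.le

lemma sv_le_norm (T : H →L[ℂ] H) (n : ℕ) : sv T n ≤ ‖T‖ := by
  simpa using sv_le' T (RankLE.zero n)

lemma sv_anti (T : H →L[ℂ] H) : Antitone (sv T) := by
  refine antitone_nat_of_succ_le fun n => ?_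
  simpa using sv_add_le T (RankLE.zero 1) n

lemma sv_rank {m : ℕ} {D : H →L[ℂ] H} (hD : RankLE m D) (n : ℕ) (hn : m ≤ n) :
    sv D n = 0 := by
  refine le_antisymm ?_ (sv_nonneg _ _)
  obtain ⟨k, rfl⟩ := Nat.exists_eq_add_of_le' hn
  have := sv_add_le 0 hD k
  rw [zero_add] at this
  exact this.trans (by simpa using sv_le_norm (0 : H →L[ℂ] H) k)

lemma mem_iff (T : H →L[ℂ] H) : MemSchatten 1 T ↔ IsCompactOperator T ∧ Summable (sv T) := by
  simp [MemSchatten]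

lemma norm_eq (T : H →L[ℂ] H) : schattenNorm 1 T = ∑' n, sv T n := by
  simp [schattenNorm]

lemma compact_rankOne (f g : H) : IsCompactOperator (rankOne f g) := by
  have h : IsCompactOperator (ContinuousLinearMap.toSpanSingleton ℂ g) := by
    exact isCompactOperator_of_locallyCompactSpace_rng (ContinuousLinearMap.toSpanSingleton ℂ g)
  exact h.comp_clm (innerSL ℂ f)

lemma compact_rank {m : ℕ} {D : H →L[ℂ] H} (hD : RankLE m D) : IsCompactOperator D := by
  obtain ⟨u, v, rfl⟩ := hD
  have : ∑ i, rankOne (u i) (v i) ∈ compactOperator (RingHom.id ℂ) H H :=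
    Submodule.sum_mem _ fun i _ => compact_rankOne _ _
  exact this

lemma mem_rank {m : ℕ} {D : H →L[ℂ] H} (hD : RankLE m D) : MemSchatten 1 D := by
  rw [mem_iff]
  refine ⟨compact_rank hD, ?_⟩
  refine summable_of_ne_finset_zero (s := Finset.range m) fun n hn => sv_rank hD n (by simpa using hn)

lemma rank_one (f g : H) : RankLE 1 (rankOne f g) := ⟨fun _ => f, fun _ => g, by simp⟩

lemma norm_rankOne_le (f g : H) : ‖rankOne f g‖ ≤ ‖f‖ * ‖g‖ := by
  refine ContinuousLinearMap.opNorm_le_bound _ (by positivity) fun x => ?_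
  rw [rankOne_apply, norm_smul]
  calc _ ≤ ‖f‖ * ‖x‖ * ‖g‖ := by gcongr; exact norm_inner_le_norm _ _
    _ = _ := by ring

lemma schatten_rankOne_le (f g : H) : schattenNorm 1 (rankOne f g) ≤ ‖f‖ * ‖g‖ := by
  rw [norm_eq, tsum_eq_single 0 fun n hn => sv_rank (rank_one f g) n (by omega)]
  exact (sv_le_norm _ _).trans (norm_rankOne_le f g)

lemma mem_sub {m : ℕ} {T D : H →L[ℂ] H} (hT : MemSchatten 1 T) (hD : RankLE m D) :
    MemSchatten 1 (T - D) := by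
  rw [mem_iff] at hT ⊢
  refine ⟨?_, ?_⟩
  · exact hT.1.sub (compact_rank hD)
  · rw [← summable_nat_add_iff m]
    refine Summable.of_nonneg_of_le (fun n => sv_nonneg _ _) (fun n => ?_) hT.2
    rw [sub_eq_add_neg]
    exact sv_add_le T hD.neg n

lemma schatten_sub_le {m : ℕ} {T D : H →L[ℂ] H} (hT : MemSchatten 1 T) (hD : RankLE m D) :
    schattenNorm 1 (T - D) ≤ 2 * (m * ‖T - D‖) + ∑' n, sv T (n + m) := by
  have h := mem_sub hT hD
  rw [mem_iff] at hT h
  rw [norm_eq, ← h.2.sum_add_tsum_nat_add (m + m)]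
  refine add_le_add ?_ ?_
  · calc _ ≤ ∑ i ∈ Finset.range (m+m), ‖T - D‖ := Finset.sum_le_sum fun i _ => sv_le_norm _ _
      _ = _ := by simp; ring
  · refine Summable.tsum_le_tsum (fun n => ?_) ((summable_nat_add_iff _).2 h.2)
      ((summable_nat_add_iff _).2 hT.2)
    rw [sub_eq_add_neg, ← add_assoc]
    exact sv_add_le T hD.neg _

end

section
variable {H : Type*} [NormedAddCommGroup H] [InnerProductSpace ℂ H] [CompleteSpace H]

lemma conj_rankOne (A : H →L[ℂ] H) (f g : H) :
    star A * rankOne f g * A = rankOne (star A f) (star A g) := by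
  ext x
  simp [rankOne_apply, ContinuousLinearMap.star_eq_adjoint, ContinuousLinearMap.adjoint_inner_left]

lemma conj_sum (A : H →L[ℂ] H) {n : ℕ} (u v : Fin n → H) :
    star A * (∑ i, rankOne (u i) (v i)) * A = ∑ i, rankOne (star A (u i)) (star A (v i)) := by
  simp only [Finset.mul_sum, Finset.sum_mul, conj_rankOne]

lemma norm_unitary_le {V : H →L[ℂ] H} (hV : V ∈ unitary (H →L[ℂ] H)) : ‖V‖ ≤ 1 := by
  refine ContinuousLinearMap.opNorm_le_bound _ (by positivity) fun x => ?_
  have : ‖V x‖ ^ 2 = ‖x‖ ^ 2 := by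
    rw [ContinuousLinearMap.apply_norm_sq_eq_inner_adjoint_left V x]
    have h := (Unitary.mem_iff.1 hV).1
    rw [ContinuousLinearMap.star_eq_adjoint] at h
    have h2 : (ContinuousLinearMap.adjoint V ∘L V) x = x := by
      change (ContinuousLinearMap.adjoint V * V) x = x
      rw [h]; rfl
    rw [h2]
    exact inner_self_eq_norm_sq x
  rw [one_mul]
  exact ((sq_eq_sq₀ (norm_nonneg _) (norm_nonneg _)).1 this).le

lemma sv_conj {V : H →L[ℂ] H} (hV : V ∈ unitary (H →L[ℂ] H)) (T : H →L[ℂ] H) (n : ℕ) :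
    sv (star V * T * V) n ≤ sv T n := by
  refine le_of_forall_pos_le_add fun ε hε => ?_
  obtain ⟨u, v, h⟩ := exists_near T n ε hε
  refine (sv_le _ n (fun i => star V (u i)) (fun i => star V (v i))).trans (le_trans ?_ h.le)
  rw [← conj_sum, ← sub_mul, ← mul_sub]
  calc _ ≤ ‖star V‖ * ‖T - ∑ i, rankOne (u i) (v i)‖ * ‖V‖ :=
        (norm_mul_le _ _).trans (mul_le_mul_of_nonneg_right (norm_mul_le _ _) (norm_nonneg _))
    _ ≤ 1 * ‖T - ∑ i, rankOne (u i) (v i)‖ * 1 := by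
        gcongr
        · exact norm_unitary_le (Unitary.star_mem hV)
        · exact norm_unitary_le hV
    _ = _ := by ring

lemma mem_conj {V : H →L[ℂ] H} (hV : V ∈ unitary (H →L[ℂ] H)) {T : H →L[ℂ] H}
    (hT : MemSchatten 1 T) : MemSchatten 1 (star V * T * V) := by
  rw [mem_iff] at hT ⊢
  refine ⟨?_, Summable.of_nonneg_of_le (fun n => sv_nonneg _ _) (sv_conj hV T) hT.2⟩
  exact (hT.1.clm_comp (star V)).comp_clm V

lemma schatten_conj {V : H →L[ℂ] H} (hV : V ∈ unitary (H →L[ℂ] H)) {T : H →L[ℂ] H}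
    (hT : MemSchatten 1 T) : schattenNorm 1 (star V * T * V) ≤ schattenNorm 1 T := by
  rw [norm_eq, norm_eq]
  exact Summable.tsum_le_tsum (sv_conj hV T) ((mem_iff _).1 (mem_conj hV hT)).2 ((mem_iff _).1 hT).2

end

section
variable {H : Type*} [NormedAddCommGroup H] [InnerProductSpace ℂ H] [CompleteSpace H]

lemma diag_rank {N : ℕ} {D : H →L[ℂ] H} (hD : RankLE N D) (b : ℕ → H) (hb : Orthonormal ℂ b)
    (S : Finset ℕ) : ∑ i ∈ S, ‖⟪b i, D (b i)⟫_ℂ‖ ≤ N * ‖D‖ := by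
  obtain ⟨u, v, hDe⟩ := hD
  let E : Submodule ℂ H := Submodule.span ℂ (Set.range v)
  have : FiniteDimensional ℂ E := FiniteDimensional.span_of_finite ℂ (Set.finite_range v)
  let e := stdOrthonormalBasis ℂ E
  have hmem : ∀ x, D x ∈ E := by
    intro x
    rw [hDe, _root_.sum_apply]
    exact Submodule.sum_mem _ fun i _ =>
      Submodule.smul_mem _ _ (Submodule.subset_span (Set.mem_range_self i))
  have hexp : ∀ x, D x = ∑ j, ⟪(e j : H), D x⟫_ℂ • (e j : H) := by
    intro x
    have := congrArg (Subtype.val) (e.sum_repr' ⟨D x, hmem x⟩)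
    simpa using this.symm
  have hcard : (Module.finrank ℂ E : ℝ) ≤ N := by
    have := finrank_range_le_card (R := ℂ) v
    rw [Fintype.card_fin] at this
    exact_mod_cast this
  have hne : ∀ j, ‖(e j : H)‖ = 1 := fun j => e.orthonormal.1 j
  have key : ∀ j, ∑ i ∈ S, ‖⟪(e j : H), D (b i)⟫_ℂ‖ * ‖⟪b i, (e j : H)⟫_ℂ‖ ≤ ‖D‖ := by
    intro j
    have h1 : ∑ i ∈ S, ‖⟪(e j : H), D (b i)⟫_ℂ‖ ^ 2 ≤ ‖D‖ ^ 2 := by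
      have := hb.sum_inner_products_le (s := S) (x := ContinuousLinearMap.adjoint D (e j))
      calc _ = ∑ i ∈ S, ‖⟪b i, ContinuousLinearMap.adjoint D (e j)⟫_ℂ‖ ^ 2 := by
            refine Finset.sum_congr rfl fun i _ => ?_
            rw [ContinuousLinearMap.adjoint_inner_right, norm_inner_symm]
        _ ≤ _ := this
        _ ≤ (‖ContinuousLinearMap.adjoint D‖ * ‖(e j : H)‖) ^ 2 := by
            gcongr; exact ContinuousLinearMap.le_opNorm _ _
        _ = _ := by rw [hne]; simp
    have h2 : ∑ i ∈ S, ‖⟪b i, (e j : H)⟫_ℂ‖ ^ 2 ≤ 1 := by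
      have := hb.sum_inner_products_le (s := S) (x := (e j : H))
      rwa [hne, one_pow] at this
    have h3 := Finset.sum_mul_sq_le_sq_mul_sq S (fun i => ‖⟪(e j : H), D (b i)⟫_ℂ‖)
      (fun i => ‖⟪b i, (e j : H)⟫_ℂ‖)
    refine (sq_le_sq₀ (Finset.sum_nonneg fun i _ => by positivity) (norm_nonneg _)).1 (h3.trans ?_)
    calc _ ≤ ‖D‖ ^ 2 * 1 := by gcongr
      _ = _ := mul_one _
  calc ∑ i ∈ S, ‖⟪b i, D (b i)⟫_ℂ‖
      ≤ ∑ i ∈ S, ∑ j, ‖⟪(e j : H), D (b i)⟫_ℂ‖ * ‖⟪b i, (e j : H)⟫_ℂ‖ := by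
        refine Finset.sum_le_sum fun i _ => ?_
        conv_lhs => rw [hexp (b i), inner_sum]
        refine (norm_sum_le _ _).trans (Finset.sum_le_sum fun j _ => ?_)
        rw [inner_smul_right, norm_mul]
    _ = ∑ j, ∑ i ∈ S, ‖⟪(e j : H), D (b i)⟫_ℂ‖ * ‖⟪b i, (e j : H)⟫_ℂ‖ := Finset.sum_comm
    _ ≤ ∑ j : Fin (Module.finrank ℂ E), ‖D‖ := Finset.sum_le_sum fun j _ => key j
    _ = Module.finrank ℂ E * ‖D‖ := by simp
    _ ≤ N * ‖D‖ := by gcongr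

lemma hasSum_diag (b : HilbertBasis ℕ ℂ H) {n : ℕ} (u v : Fin n → H) :
    HasSum (fun i => ⟪(b i : H), (∑ j, rankOne (u j) (v j)) (b i)⟫_ℂ) (∑ j, ⟪u j, v j⟫_ℂ) := by
  have := hasSum_sum (s := Finset.univ) fun (j : Fin n) _ => b.hasSum_inner_mul_inner (u j) (v j)
  refine this.congr_fun fun i => ?_
  simp [_root_.sum_apply, inner_sum, rankOne_apply, inner_smul_right]

lemma approx (b : HilbertBasis ℕ ℂ H) (T : H →L[ℂ] H) (hT : MemSchatten 1 T) (ε : ℝ)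
    (hε : 0 < ε) : ∃ (n : ℕ) (u v : Fin n → H),
      schattenNorm 1 (T - ∑ i, rankOne (u i) (v i)) < ε ∧
      ‖traceAlong b T - ∑ i, ⟪u i, v i⟫_ℂ‖ < ε := by
  have hS := ((mem_iff T).1 hT).2
  choose u v huv using fun k : ℕ => exists_near T (2 ^ k) ((1/4 : ℝ) ^ k) (by positivity)
  set F : ℕ → H →L[ℂ] H := fun k => ∑ i, rankOne (u k i) (v k i) with hF
  have hrank : ∀ k, RankLE (2 ^ k) (F k) := fun k => ⟨u k, v k, rfl⟩
  have hcond : Summable fun k : ℕ => (2 : ℝ) ^ k * sv T (2 ^ k) :=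
    (summable_condensed_iff_of_nonneg (sv_nonneg T) fun m n _ h => sv_anti T h).2 hS
  have hgeo : Summable fun k : ℕ => (1/2 : ℝ) ^ k :=
    summable_geometric_of_lt_one (by norm_num) (by norm_num)
  set a : ℕ → ℝ := fun k => (2 : ℝ) ^ k * sv T (2 ^ k) + (1/2) ^ k with ha
  have haS : Summable a := hcond.add hgeo
  have hRk : ∀ k, (2 : ℝ) ^ k * ‖T - F k‖ ≤ a k := by
    intro k
    calc _ ≤ (2 : ℝ) ^ k * (sv T (2 ^ k) + (1/4) ^ k) := by gcongr; exact (huv k).le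
      _ = _ := by rw [ha, mul_add, ← mul_pow]; norm_num
  have ha0 : Tendsto a atTop (nhds 0) := haS.tendsto_atTop_zero
  have hann : ∀ k, 0 ≤ a k := fun k => (by positivity : (0:ℝ) ≤ 2 ^ k * ‖T - F k‖).trans (hRk k)
  -- the trace norms go to zero
  have h1 : Tendsto (fun k => schattenNorm 1 (T - F k)) atTop (nhds 0) := by
    have hlim : Tendsto (fun k : ℕ => 2 * a k + ∑' n, sv T (n + 2 ^ k)) atTop (nhds 0) := by
      have h := (tendsto_sum_nat_add (sv T)).comp
        (tendsto_pow_atTop_atTop_of_one_lt (one_lt_two : (1:ℕ) < 2))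
      simpa using (ha0.const_mul 2).add h
    refine squeeze_zero (fun k => ?_) (fun k => ?_) hlim
    · rw [norm_eq]; exact tsum_nonneg fun n => sv_nonneg _ _
    · refine (schatten_sub_le hT (hrank k)).trans ?_
      have := hRk k
      push_cast
      linarith
  have hopn : Tendsto (fun k => F k) atTop (nhds T) := by
    rw [tendsto_iff_norm_sub_tendsto_zero]
    refine squeeze_zero (fun k => norm_nonneg _) (fun k => ?_) ha0
    rw [norm_sub_rev]
    refine le_trans ?_ (hRk k)
    have : (1:ℝ) ≤ 2 ^ k := one_le_pow₀ (by norm_num)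
    nlinarith [norm_nonneg (T - F k)]
  set c : ℕ → ℝ := fun k => 3 * a k + 3 * a (k + 1) with hc
  have hcS : Summable c := (haS.mul_left 3).add (((summable_nat_add_iff 1).2 haS).mul_left 3)
  have hcnn : ∀ k, 0 ≤ c k := fun k => by
    have h1 := hann k
    have h2 := hann (k+1)
    simp only [hc]; linarith
  have hstep : ∀ k (S : Finset ℕ), ∑ i ∈ S, ‖⟪(b i : H), (F (k+1) - F k) (b i)⟫_ℂ‖ ≤ c k := by
    intro k S
    have hr : RankLE (2 ^ (k+1) + 2 ^ k) (F (k+1) - F k) := by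
      rw [sub_eq_add_neg]; exact (hrank _).add (hrank _).neg
    refine (diag_rank hr b b.orthonormal S).trans ?_
    have h2 : ‖F (k+1) - F k‖ ≤ ‖T - F (k+1)‖ + ‖T - F k‖ := by
      have : F (k+1) - F k = -(T - F (k+1)) + (T - F k) := by abel
      rw [this]
      refine (norm_add_le _ _).trans ?_
      rw [norm_neg]
    have h3 := hRk k
    have h4 := hRk (k+1)
    have h5 : (0:ℝ) ≤ 2 ^ k * ‖T - F (k+1)‖ := by positivity
    push_cast
    rw [pow_succ] at h4 ⊢
    calc _ ≤ ((2:ℝ) ^ k * 2 + 2 ^ k) * (‖T - F (k+1)‖ + ‖T - F k‖) := by gcongr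
      _ ≤ _ := by simp only [hc]; nlinarith
  have hfin : ∀ k m (S : Finset ℕ),
      ∑ i ∈ S, ‖⟪(b i : H), (F (m+k) - F k) (b i)⟫_ℂ‖ ≤ ∑ j ∈ Finset.range m, c (j + k) := by
    intro k m S
    induction m with
    | zero => simp
    | succ m ih =>
      rw [Finset.sum_range_succ]
      refine le_trans ?_ (add_le_add ih (hstep (m+k) S))
      rw [← Finset.sum_add_distrib]
      refine Finset.sum_le_sum fun i _ => ?_
      refine le_trans (le_of_eq ?_) (norm_add_le _ _)
      rw [← inner_add_right, ← _root_.add_apply]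
      congr 3
      rw [show m + 1 + k = m + k + 1 by ring]
      abel
  have hlimS : ∀ k (S : Finset ℕ),
      ∑ i ∈ S, ‖⟪(b i : H), (T - F k) (b i)⟫_ℂ‖ ≤ ∑' j, c (j + k) := by
    intro k S
    have hl : Tendsto (fun m => ∑ i ∈ S, ‖⟪(b i : H), (F (m+k) - F k) (b i)⟫_ℂ‖) atTop
        (nhds (∑ i ∈ S, ‖⟪(b i : H), (T - F k) (b i)⟫_ℂ‖)) := by
      refine tendsto_finsetSum _ fun i _ => Tendsto.norm ?_
      refine Tendsto.inner tendsto_const_nhds ?_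
      have h := (hopn.comp (tendsto_add_atTop_nat k)).sub_const (F k)
      exact ((ContinuousLinearMap.apply ℂ H (b i : H)).continuous.tendsto _).comp h
    refine le_of_tendsto' hl fun m => (hfin k m S).trans ?_
    exact Summable.sum_le_tsum _ (fun j _ => hcnn _) ((summable_nat_add_iff k).2 hcS)
  have htr : ∀ k, ‖traceAlong b T - ∑ i, ⟪u k i, v k i⟫_ℂ‖ ≤ ∑' j, c (j + k) := by
    intro k
    have hs : Summable fun i => ‖⟪(b i : H), (T - F k) (b i)⟫_ℂ‖ :=
      summable_of_sum_le (fun i => norm_nonneg _) (hlimS k)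
    have hd := hasSum_diag b (u k) (v k)
    have e1 : HasSum (fun i => ⟪(b i : H), T (b i)⟫_ℂ)
        (∑' i, ⟪(b i : H), (T - F k) (b i)⟫_ℂ + ∑ i, ⟪u k i, v k i⟫_ℂ) := by
      refine (hs.of_norm.hasSum.add hd).congr_fun ?_
      intro i
      rw [← inner_add_right, ← _root_.add_apply]
      simp [hF]
    rw [traceAlong, e1.tsum_eq, add_sub_cancel_right]
    refine (norm_tsum_le_tsum_norm hs).trans ?_
    exact Real.tsum_le_of_sum_le (fun i => norm_nonneg _) (hlimS k)
  have h2 := tendsto_sum_nat_add c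
  obtain ⟨k, hk1, hk2⟩ := ((h1.eventually_lt_const hε).and (h2.eventually_lt_const hε)).exists
  exact ⟨2 ^ k, u k, v k, hk1, (htr k).trans_lt hk2⟩

end

section
variable {H : Type*} [NormedAddCommGroup H] [InnerProductSpace ℂ H] [CompleteSpace H]

lemma exists_op (L : (H →L[ℂ] H) → ℂ)
    (hL_add : ∀ A B, MemSchatten 1 A → MemSchatten 1 B → L (A + B) = L A + L B)
    (hL_smul : ∀ (c : ℂ) A, MemSchatten 1 A → L (c • A) = c * L A)
    (hL_bdd : ∃ M : ℝ, ∀ A, MemSchatten 1 A → ‖L A‖ ≤ M * schattenNorm 1 A) :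
    ∃ A : H →L[ℂ] H, ∀ u v, L (rankOne u v) = ⟪A u, v⟫_ℂ := by
  obtain ⟨M, hM⟩ := hL_bdd
  have hm : ∀ u v : H, MemSchatten 1 (rankOne u v) := fun u v => mem_rank (rank_one u v)
  let B : H →ₗ⋆[ℂ] H →ₗ[ℂ] ℂ := LinearMap.mk₂'ₛₗ (starRingEnd ℂ) (RingHom.id ℂ)
    (fun u v => L (rankOne u v))
    (fun u u' v => by
      rw [← hL_add _ _ (hm _ _) (hm _ _)]
      congr 1; ext x; simp [rankOne_apply, inner_add_left, add_smul])
    (fun c u v => by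
      rw [smul_eq_mul, ← hL_smul _ _ (hm _ _)]
      congr 1; ext x; simp [rankOne_apply, mul_smul, smul_comm ⟪u, x⟫_ℂ])
    (fun u v v' => by
      rw [← hL_add _ _ (hm _ _) (hm _ _)]
      congr 1; ext x; simp [rankOne_apply])
    (fun c u v => by
      rw [RingHom.id_apply, smul_eq_mul, ← hL_smul _ _ (hm _ _)]
      congr 1; ext x; simp [rankOne_apply, smul_comm ⟪u, x⟫_ℂ])
  have hB : ∀ u v, ‖B u v‖ ≤ |M| * ‖u‖ * ‖v‖ := by
    intro u v
    have h0 : 0 ≤ schattenNorm 1 (rankOne u v) := by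
      rw [norm_eq]; exact tsum_nonneg fun n => sv_nonneg _ _
    calc ‖B u v‖ ≤ M * schattenNorm 1 (rankOne u v) := hM _ (hm u v)
      _ ≤ |M| * schattenNorm 1 (rankOne u v) := by gcongr; exact le_abs_self M
      _ ≤ |M| * (‖u‖ * ‖v‖) := by gcongr; exact schatten_rankOne_le u v
      _ = _ := by ring
  let B' : H →L⋆[ℂ] H →L[ℂ] ℂ := B.mkContinuous₂ |M| hB
  refine ⟨InnerProductSpace.continuousLinearMapOfBilin B', fun u v => ?_⟩
  rw [InnerProductSpace.continuousLinearMapOfBilin_apply]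
  rfl

lemma weak_null {f : ℕ → H} (hf : Orthonormal ℂ f) (y : H) :
    Tendsto (fun n => ⟪y, f n⟫_ℂ) atTop (nhds 0) := by
  have h := (hf.inner_products_summable (x := y)).tendsto_atTop_zero
  rw [tendsto_zero_iff_norm_tendsto_zero]
  have h2 := h.sqrt
  simpa [norm_inner_symm] using h2

lemma select_one (A : H →L[ℂ] H) {f : ℕ → H} (hf : Orthonormal ℂ f) {w : ℂ}
    (hw : Tendsto (fun n => ⟪A (f n), f n⟫_ℂ) atTop (nhds w)) (X : Finset H) (δ : ℝ)
    (hδ : 0 < δ) : ∃ g : H, ‖g‖ = 1 ∧ ‖⟪A g, g⟫_ℂ - w‖ < δ ∧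
      ∀ x ∈ X, ⟪x, g⟫_ℂ = 0 ∧ ‖⟪A x, g⟫_ℂ‖ < δ ∧ ‖⟪A g, x⟫_ℂ‖ < δ := by
  let E : Submodule ℂ H := Submodule.span ℂ (X : Set H)
  have : FiniteDimensional ℂ E := FiniteDimensional.span_of_finite ℂ X.finite_toSet
  let e := stdOrthonormalBasis ℂ E
  let P : H → H := fun x => ∑ j, ⟪(e j : H), x⟫_ℂ • (e j : H)
  have hP : Tendsto (fun n => P (f n)) atTop (nhds 0) := by
    have : Tendsto (fun n => P (f n)) atTop
        (nhds (∑ j : Fin (Module.finrank ℂ E), (0:ℂ) • (e j : H))) :=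
      tendsto_finsetSum _ fun j _ => (weak_null hf _).smul_const _
    simpa using this
  let d : ℕ → H := fun n => f n - P (f n)
  have hd : ∀ n, ∀ x ∈ X, ⟪x, d n⟫_ℂ = 0 := by
    intro n x hx
    have hxE : x ∈ E := Submodule.subset_span hx
    have hexp : x = ∑ j, ⟪(e j : H), x⟫_ℂ • (e j : H) := by
      have := congrArg (Subtype.val) (e.sum_repr' ⟨x, hxE⟩)
      simpa using this.symm
    have hej : ∀ j, ⟪(e j : H), d n⟫_ℂ = 0 := by
      intro j
      have ho : ∀ i, ⟪(e j : H), (e i : H)⟫_ℂ = if j = i then 1 else 0 := fun i =>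
        (orthonormal_iff_ite.1 e.orthonormal) j i
      simp [d, P, inner_sub_right, inner_sum, inner_smul_right, ho]
    rw [hexp, sum_inner]
    exact Finset.sum_eq_zero fun j _ => by rw [inner_smul_left, hej, mul_zero]
  have hfn : ∀ n, ‖f n‖ = 1 := hf.1
  have hdn : Tendsto (fun n => ‖d n‖) atTop (nhds 1) := by
    have h1 : Tendsto (fun n => ‖d n‖ - ‖f n‖) atTop (nhds 0) := by
      refine squeeze_zero_norm (fun n => ?_) (tendsto_norm_zero.comp hP)
      rw [Real.norm_eq_abs]
      refine (abs_norm_sub_norm_le _ _).trans (le_of_eq ?_)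
      simp [d]
    have h2 := h1.add_const 1
    simpa [hfn] using h2
  let g : ℕ → H := fun n => ((‖d n‖⁻¹ : ℝ) : ℂ) • d n
  have hgf : Tendsto (fun n => g n - f n) atTop (nhds 0) := by
    have h1 : Tendsto (fun n => ((‖d n‖⁻¹ : ℝ) : ℂ) - 1) atTop (nhds 0) := by
      have h := (hdn.inv₀ one_ne_zero)
      have h' := ((Complex.continuous_ofReal.tendsto _).comp h).sub_const 1
      simpa using h'
    have h2 : Tendsto (fun n => (((‖d n‖⁻¹ : ℝ) : ℂ) - 1) • d n) atTop (nhds 0) := by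
      rw [tendsto_zero_iff_norm_tendsto_zero] at h1 ⊢
      simp only [norm_smul]
      simpa using h1.mul hdn
    have h3 := h2.sub hP
    rw [sub_zero] at h3
    refine h3.congr fun n => ?_
    simp only [g, d, sub_smul, one_smul]
    abel
  have hgn : ∀ᶠ n in atTop, ‖g n‖ = 1 := by
    filter_upwards [hdn.eventually_ne one_ne_zero] with n hn
    simp only [g, norm_smul, Complex.norm_real, norm_inv, norm_norm]
    exact inv_mul_cancel₀ hn
  have hgw : ∀ y, Tendsto (fun n => ⟪y, g n⟫_ℂ) atTop (nhds 0) := by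
    intro y
    have h1 : Tendsto (fun n => ⟪y, g n - f n⟫_ℂ) atTop (nhds ⟪y, (0:H)⟫_ℂ) :=
      tendsto_const_nhds.inner hgf
    have := (weak_null hf y).add h1
    simp only [inner_zero_right, add_zero] at this
    refine this.congr fun n => ?_
    rw [← inner_add_right]; congr 1; abel
  have hAg : Tendsto (fun n => ⟪A (g n), g n⟫_ℂ) atTop (nhds w) := by
    have hb : Tendsto (fun n => ⟪A (g n), g n⟫_ℂ - ⟪A (f n), f n⟫_ℂ) atTop (nhds 0) := by
      have hl : Tendsto (fun n => ‖A‖ * ‖g n - f n‖ * ‖g n‖ + ‖A‖ * ‖g n - f n‖)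
          atTop (nhds 0) := by
        have h1 : Tendsto (fun n => ‖g n - f n‖) atTop (nhds 0) := tendsto_norm_zero.comp hgf
        have h2 : Tendsto (fun n => ‖g n‖) atTop (nhds 1) :=
          tendsto_const_nhds.congr' (hgn.mono fun n hn => hn.symm)
        simpa using ((h1.const_mul ‖A‖).mul h2).add (h1.const_mul ‖A‖)
      refine squeeze_zero_norm (fun n => ?_) hl
      have : ⟪A (g n), g n⟫_ℂ - ⟪A (f n), f n⟫_ℂ
          = ⟪A (g n - f n), g n⟫_ℂ + ⟪A (f n), g n - f n⟫_ℂ := by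
        rw [map_sub, inner_sub_left, inner_sub_right]; ring
      rw [this]
      refine (norm_add_le _ _).trans (add_le_add ?_ ?_)
      · refine (norm_inner_le_norm _ _).trans ?_
        gcongr; exact A.le_opNorm _
      · refine (norm_inner_le_norm _ _).trans ?_
        gcongr
        refine (A.le_opNorm _).trans ?_
        rw [hfn, mul_one]
    simpa using hb.add hw
  have hAx : ∀ᶠ n in atTop, ∀ x ∈ X, ‖⟪A x, g n⟫_ℂ‖ < δ ∧ ‖⟪A (g n), x⟫_ℂ‖ < δ := by
    rw [Filter.eventually_all_finset]
    intro x _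
    have h1 := (tendsto_norm_zero.comp (hgw (A x))).eventually_lt_const hδ
    have h2 := (tendsto_norm_zero.comp (hgw (ContinuousLinearMap.adjoint A x))).eventually_lt_const hδ
    filter_upwards [h1, h2] with n hn1 hn2
    refine ⟨hn1, ?_⟩
    rw [norm_inner_symm, ← ContinuousLinearMap.adjoint_inner_left]
    exact hn2
  have hAw : ∀ᶠ n in atTop, ‖⟪A (g n), g n⟫_ℂ - w‖ < δ :=
    (tendsto_iff_norm_sub_tendsto_zero.1 hAg).eventually_lt_const hδ
  obtain ⟨n, h1, h2, h3⟩ := (hgn.and (hAw.and hAx)).exists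
  refine ⟨g n, h1, h2, fun x hx => ⟨?_, h3 x hx⟩⟩
  simp [g, inner_smul_right, hd n x hx]

lemma select (A : H →L[ℂ] H) {f : ℕ → H} (hf : Orthonormal ℂ f) {w : ℂ}
    (hw : Tendsto (fun n => ⟪A (f n), f n⟫_ℂ) atTop (nhds w)) (δ : ℝ)
    (hδ : 0 < δ) (m : ℕ) : ∀ X : Finset H, ∃ g : Fin m → H, 
      (∀ i j, ⟪g i, g j⟫_ℂ = if i = j then 1 else 0) ∧
      (∀ i j, ‖⟪A (g i), g j⟫_ℂ - if i = j then w else 0‖ < δ) ∧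
      ∀ x ∈ X, ∀ i, ⟪x, g i⟫_ℂ = 0 ∧ ‖⟪A x, g i⟫_ℂ‖ < δ ∧ ‖⟪A (g i), x⟫_ℂ‖ < δ := by
  classical
  induction m with
  | zero => exact fun X => ⟨Fin.elim0, fun i => i.elim0, fun i => i.elim0, fun x _ i => i.elim0⟩
  | succ m ih =>
    intro X
    obtain ⟨g0, h1, h2, h3⟩ := select_one A hf hw X δ hδ
    obtain ⟨g, hg1, hg2, hg3⟩ := ih (insert g0 X)
    have h0 := hg3 g0 (Finset.mem_insert_self _ _)
    refine ⟨Fin.cons g0 g, ?_, ?_, ?_⟩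
    · intro i j
      refine Fin.cases ?_ (fun i => ?_) i <;> refine Fin.cases ?_ (fun j => ?_) j
      · simp [inner_self_eq_norm_sq_to_K, h1]
      · simpa [(Fin.succ_ne_zero _).symm] using (h0 j).1
      · simpa using inner_eq_zero_symm.1 (h0 i).1
      · simpa using hg1 i j
    · intro i j
      refine Fin.cases ?_ (fun i => ?_) i <;> refine Fin.cases ?_ (fun j => ?_) j
      · simpa using h2
      · simpa [(Fin.succ_ne_zero _).symm] using (h0 j).2.1
      · simpa using (h0 i).2.2
      · simpa using hg2 i j
    · intro x hx i
      refine Fin.cases ?_ (fun i => ?_) i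
      · simpa using h3 x hx
      · simpa using hg3 x (Finset.mem_insert_of_mem hx) i

lemma star_rankOne (f g : H) : star (rankOne f g) = rankOne g f := by
  rw [ContinuousLinearMap.star_eq_adjoint]
  symm
  rw [ContinuousLinearMap.eq_adjoint_iff]
  intro x y
  simp [rankOne_apply, inner_smul_left, inner_smul_right, mul_comm]

lemma mul_rankOne (A : H →L[ℂ] H) (f g : H) : A * rankOne f g = rankOne f (A g) := by
  ext x; simp [rankOne_apply]

lemma rankOne_neg (f g : H) : rankOne f (-g) = - rankOne f g := by
  ext x; simp [rankOne_apply]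

lemma rotation {k : ℕ} (e g : Fin k → H) (he : ∀ i j, ⟪e i, e j⟫_ℂ = if i = j then 1 else 0)
    (hg : ∀ i j, ⟪g i, g j⟫_ℂ = if i = j then 1 else 0) (heg : ∀ i j, ⟪e i, g j⟫_ℂ = 0)
    (a s : ℝ) (has : a ^ 2 + s ^ 2 = 1) :
    ∃ W ∈ unitary (H →L[ℂ] H), ∀ j, W (e j) = (a : ℂ) • e j + (s : ℂ) • g j := by
  have hge : ∀ i j, ⟪g i, e j⟫_ℂ = 0 := fun i j => inner_eq_zero_symm.1 (heg j i)
  set A : H →L[ℂ] H := ∑ j, (rankOne (e j) (g j) - rankOne (g j) (e j)) with hA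
  have hAe : ∀ j, A (e j) = g j := by
    intro j; simp [hA, _root_.sum_apply, rankOne_apply, he, hge]
  have hAg : ∀ j, A (g j) = - e j := by
    intro j; simp [hA, _root_.sum_apply, rankOne_apply, hg, heg]
  have hstar : star A = -A := by
    rw [hA, star_sum, ← Finset.sum_neg_distrib]
    refine Finset.sum_congr rfl fun j _ => ?_
    rw [star_sub, star_rankOne, star_rankOne, neg_sub]
  have hA3 : A * (A * A) = -A := by
    have h2 : A * A = ∑ j, (-rankOne (e j) (e j) - rankOne (g j) (g j)) := by
      conv_lhs => rhs; rw [hA]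
      rw [Finset.mul_sum]
      refine Finset.sum_congr rfl fun j _ => ?_
      rw [mul_sub, mul_rankOne, mul_rankOne, hAe, hAg, rankOne_neg]
    rw [h2, Finset.mul_sum]
    conv_rhs => rw [hA]
    rw [← Finset.sum_neg_distrib]
    refine Finset.sum_congr rfl fun j _ => ?_
    rw [mul_sub, mul_neg, mul_rankOne, mul_rankOne, hAe, hAg, rankOne_neg]
    abel
  have hA4 : A * (A * (A * A)) = -(A * A) := by rw [hA3, mul_neg]
  set c : ℂ := 1 - (a : ℂ) with hc
  have hcs : 2 * c - c * c - (s:ℂ) * s = 0 := by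
    have : ((a:ℂ)) ^ 2 + (s:ℂ) ^ 2 = 1 := by exact_mod_cast has
    rw [hc]; linear_combination -this
  let W : H →L[ℂ] H := 1 + c • (A * A) + (s : ℂ) • A
  have hcstar : star c = c := by simp [hc]
  have hWs : star W = 1 + c • (A * A) - (s : ℂ) • A := by
    simp only [W, star_add, star_one, star_smul, star_mul, hstar, hcstar]
    simp [sub_eq_add_neg]
  have hz : (2 * c - c * c - (s:ℂ) * s) • (A * A) = 0 := by rw [hcs, zero_smul]
  refine ⟨W, Unitary.mem_iff.2 ⟨?_, ?_⟩, fun j => ?_⟩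
  · rw [hWs]
    simp only [W, mul_add, add_mul, sub_mul, mul_one, one_mul, smul_mul_assoc, mul_smul_comm,
      mul_assoc, hA3, mul_neg, smul_neg]
    linear_combination (norm := module) hz
  · rw [hWs]
    simp only [W, mul_add, add_mul, mul_sub, mul_one, one_mul, smul_mul_assoc, mul_smul_comm,
      mul_assoc, hA3, mul_neg, smul_neg]
    linear_combination (norm := module) hz
  · simp only [W, hc, _root_.add_apply, _root_.smul_apply, one_apply_eq_self,
      mul_apply_eq_comp, hAe, hAg]
    module

end

section
variable {H : Type*} [NormedAddCommGroup H] [InnerProductSpace ℂ H] [CompleteSpace H]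

lemma main_fin (A : H →L[ℂ] H) {f : ℕ → H} (hf : Orthonormal ℂ f) {w : ℂ}
    (hw : Tendsto (fun n => ⟪A (f n), f n⟫_ℂ) atTop (nhds w)) (t : ℝ) (ht0 : 0 ≤ t) (ht1 : t ≤ 1)
    {n : ℕ} (u v : Fin n → H) (ε : ℝ) (hε : 0 < ε) :
    ∃ W ∈ unitary (H →L[ℂ] H), ‖∑ i, ⟪A (W (u i)), W (v i)⟫_ℂ -
      ((t : ℂ) * ((∑ i, ⟪u i, v i⟫_ℂ) * w) + (1 - (t : ℂ)) * ∑ i, ⟪A (u i), v i⟫_ℂ)‖ < ε := by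
  classical
  let E : Submodule ℂ H := Submodule.span ℂ (Set.range u ∪ Set.range v)
  have : FiniteDimensional ℂ E :=
    FiniteDimensional.span_of_finite ℂ ((Set.finite_range u).union (Set.finite_range v))
  let e0 := stdOrthonormalBasis ℂ E
  let e : Fin (Module.finrank ℂ E) → H := fun j => (e0 j : H)
  have hexp : ∀ x ∈ E, x = ∑ j, ⟪e j, x⟫_ℂ • e j := by
    intro x hx
    have := congrArg (Subtype.val) (e0.sum_repr' ⟨x, hx⟩)
    simpa using this.symm
  have hu : ∀ i, u i ∈ E := fun i => Submodule.subset_span (Or.inl ⟨i, rfl⟩)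
  have hv : ∀ i, v i ∈ E := fun i => Submodule.subset_span (Or.inr ⟨i, rfl⟩)
  have ho : ∀ i j, ⟪e i, e j⟫_ℂ = if i = j then 1 else 0 := fun i j =>
        (orthonormal_iff_ite.1 e0.orthonormal) i j
  set K : ℝ := ∑ i, ∑ p, ∑ q, ‖⟪e p, u i⟫_ℂ‖ * ‖⟪e q, v i⟫_ℂ‖ with hK
  have hK0 : 0 ≤ K := Finset.sum_nonneg fun i _ => Finset.sum_nonneg fun p _ =>
    Finset.sum_nonneg fun q _ => by positivity
  set δ : ℝ := ε / (3 * K + 1) with hδd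
  have hδ : 0 < δ := by positivity
  have hδK : 3 * δ * K < ε := by
    have : δ * (3 * K + 1) = ε := by rw [hδd]; field_simp
    nlinarith
  obtain ⟨g, hg1, hg2, hg3⟩ := select A hf hw δ hδ (Module.finrank ℂ E) (Finset.univ.image e)
  have hg3' : ∀ p q, ⟪e p, g q⟫_ℂ = 0 ∧ ‖⟪A (e p), g q⟫_ℂ‖ < δ ∧ ‖⟪A (g q), e p⟫_ℂ‖ < δ :=
    fun p q => hg3 (e p) (Finset.mem_image_of_mem _ (Finset.mem_univ _)) q
  set a : ℝ := √(1 - t) with ha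
  set s : ℝ := √t with hs
  have ha2 : a ^ 2 = 1 - t := Real.sq_sqrt (by linarith)
  have hs2 : s ^ 2 = t := Real.sq_sqrt ht0
  have ha0 : 0 ≤ a := Real.sqrt_nonneg _
  have hs0 : 0 ≤ s := Real.sqrt_nonneg _
  have has : a * s ≤ 1 := by nlinarith [sq_nonneg (a - s)]
  obtain ⟨W, hW, hWe⟩ := rotation e g ho hg1 (fun p q => (hg3' p q).1) a s (by rw [ha2, hs2]; ring)
  refine ⟨W, hW, ?_⟩
  let Q : H →L[ℂ] H := star W * A * W - (starRingEnd ℂ (t * w)) • 1 - (1 - (t:ℂ)) • A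
  have hQ : ∀ x y, ⟪Q x, y⟫_ℂ = ⟪A (W x), W y⟫_ℂ - t * (⟪x, y⟫_ℂ * w) - (1 - (t:ℂ)) * ⟪A x, y⟫_ℂ := by
    intro x y
    have h1 : ⟪(star W * A * W) x, y⟫_ℂ = ⟪A (W x), W y⟫_ℂ := by
      rw [ContinuousLinearMap.star_eq_adjoint, mul_apply_eq_comp, mul_apply_eq_comp,
        ContinuousLinearMap.adjoint_inner_left]
    have h2 : ⟪((starRingEnd ℂ (t * w)) • (1 : H →L[ℂ] H)) x, y⟫_ℂ = t * (⟪x, y⟫_ℂ * w) := by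
      rw [_root_.smul_apply, one_apply_eq_self, inner_smul_left, Complex.conj_conj]; ring
    have h3 : ⟪((1 - (t:ℂ)) • A) x, y⟫_ℂ = (1 - (t:ℂ)) * ⟪A x, y⟫_ℂ := by
      rw [_root_.smul_apply, inner_smul_left]; simp
    simp only [Q]
    rw [_root_.sub_apply, _root_.sub_apply, inner_sub_left, inner_sub_left, h1, h2, h3]
  have hQe : ∀ p q, ‖⟪Q (e p), e q⟫_ℂ‖ ≤ 3 * δ := by
    intro p q
    have haC : (a:ℂ) * a = 1 - t := by rw [← sq]; exact_mod_cast ha2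
    have hsC : (s:ℂ) * s = t := by rw [← sq]; exact_mod_cast hs2
    have : ⟪Q (e p), e q⟫_ℂ = (t : ℂ) * (⟪A (g p), g q⟫_ℂ - if p = q then w else 0)
        + ((a * s : ℝ) : ℂ) * (⟪A (e p), g q⟫_ℂ) + ((a * s : ℝ) : ℂ) * ⟪A (g p), e q⟫_ℂ := by
      have hif : (if p = q then w else 0) = (if p = q then (1:ℂ) else 0) * w := by
        split_ifs <;> simp
      rw [hQ, hWe, hWe, ho, hif]
      simp only [map_add, map_smul, inner_add_left, inner_add_right, inner_smul_left,
        inner_smul_right, Complex.conj_ofReal]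
      push_cast
      linear_combination ⟪A (e p), e q⟫_ℂ * haC + ⟪A (g p), g q⟫_ℂ * hsC
    rw [this]
    refine (norm_add₃_le).trans ?_
    rw [norm_mul, norm_mul, norm_mul, Complex.norm_real, Complex.norm_real,
      Real.norm_of_nonneg ht0, Real.norm_of_nonneg (by positivity : 0 ≤ a * s)]
    have h1 := (hg2 p q).le
    have h2 := (hg3' p q).2.1.le
    have h3 := (hg3' q p).2.2.le
    have e1 := mul_le_mul ht1 h1 (norm_nonneg _) zero_le_one
    have e2 := mul_le_mul has h2 (norm_nonneg _) zero_le_one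
    have e3 := mul_le_mul has h3 (norm_nonneg _) zero_le_one
    linarith
  have hsum : ∑ i, ⟪A (W (u i)), W (v i)⟫_ℂ -
      ((t : ℂ) * ((∑ i, ⟪u i, v i⟫_ℂ) * w) + (1 - (t : ℂ)) * ∑ i, ⟪A (u i), v i⟫_ℂ)
      = ∑ i, ⟪Q (u i), v i⟫_ℂ := by
    simp only [hQ, Finset.sum_sub_distrib, Finset.sum_mul, Finset.mul_sum]
    ring
  rw [hsum]
  refine lt_of_le_of_lt ?_ hδK
  rw [hK, Finset.mul_sum]
  refine (norm_sum_le _ _).trans (Finset.sum_le_sum fun i _ => ?_)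
  have : ⟪Q (u i), v i⟫_ℂ = ∑ p, ∑ q,
      (starRingEnd ℂ ⟪e p, u i⟫_ℂ) * (⟪e q, v i⟫_ℂ * ⟪Q (e p), e q⟫_ℂ) := by
    conv_lhs => rw [hexp _ (hu i), hexp _ (hv i), map_sum, sum_inner]
    refine Finset.sum_congr rfl fun p _ => ?_
    rw [map_smul, inner_smul_left, inner_sum, Finset.mul_sum]
    refine Finset.sum_congr rfl fun q _ => ?_
    rw [inner_smul_right]
  rw [this, Finset.mul_sum]
  refine (norm_sum_le _ _).trans (Finset.sum_le_sum fun p _ => ?_)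
  rw [Finset.mul_sum]
  refine (norm_sum_le _ _).trans (Finset.sum_le_sum fun q _ => ?_)
  rw [norm_mul, norm_mul, RCLike.norm_conj]
  calc _ ≤ ‖⟪e p, u i⟫_ℂ‖ * (‖⟪e q, v i⟫_ℂ‖ * (3 * δ)) := by gcongr; exact hQe p q
    _ = _ := by ring

lemma L_sum (L : (H →L[ℂ] H) → ℂ)
    (hL_add : ∀ A B, MemSchatten 1 A → MemSchatten 1 B → L (A + B) = L A + L B)
    (hL_smul : ∀ (c : ℂ) A, MemSchatten 1 A → L (c • A) = c * L A)
    {n : ℕ} (u v : Fin n → H) : L (∑ i, rankOne (u i) (v i)) = ∑ i, L (rankOne (u i) (v i)) := by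
  induction n with
  | zero => simpa using hL_smul 0 0 (mem_rank (RankLE.zero 0))
  | succ n ih =>
    rw [Fin.sum_univ_succ, Fin.sum_univ_succ, ← ih, hL_add]
    · exact mem_rank (rank_one _ _)
    · exact mem_rank ⟨fun i : Fin n => u i.succ, fun i => v i.succ, rfl⟩

lemma main_approx (b : HilbertBasis ℕ ℂ H)
    (T : H →L[ℂ] H) (hT : MemSchatten 1 T)
    (L : (H →L[ℂ] H) → ℂ)
    (hL_add : ∀ A B, MemSchatten 1 A → MemSchatten 1 B → L (A + B) = L A + L B)
    (hL_smul : ∀ (c : ℂ) A, MemSchatten 1 A → L (c • A) = c * L A)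
    (hL_bdd : ∃ M : ℝ, ∀ A, MemSchatten 1 A → ‖L A‖ ≤ M * schattenNorm 1 A)
    (w : ℂ) (hw : w ∈ essRange L) (U : H →L[ℂ] H) (hU : U ∈ unitary (H →L[ℂ] H))
    (t : ℝ) (ht0 : 0 ≤ t) (ht1 : t ≤ 1) (ε : ℝ) (hε : 0 < ε) :
    ∃ V ∈ unitary (H →L[ℂ] H), ‖L (star V * T * V) -
      ((t : ℂ) * (traceAlong b T * w) + (1 - (t : ℂ)) * L (star U * T * U))‖ < ε := by
  obtain ⟨A, hA⟩ := exists_op L hL_add hL_smul hL_bdd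
  obtain ⟨M, hM⟩ := hL_bdd
  obtain ⟨f, hf, hfw⟩ := hw
  simp only [hA] at hfw
  set C : ℝ := 2 * |M| + ‖w‖ + 1 with hC
  have hC0 : 0 < C := by positivity
  set η : ℝ := ε / 2 / C with hη
  have hη0 : 0 < η := by positivity
  have hηC : η * C = ε / 2 := by rw [hη]; field_simp
  obtain ⟨n, u, v, h1, h2⟩ := approx b T hT η hη0
  set F : H →L[ℂ] H := ∑ i, rankOne (u i) (v i) with hF
  have hFr : RankLE n F := ⟨u, v, rfl⟩
  have hR := mem_sub hT hFr
  have hLR : ∀ V ∈ unitary (H →L[ℂ] H), ‖L (star V * T * V) - L (star V * F * V)‖ ≤ |M| * η := by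
    intro V hV
    have e1 : star V * T * V = star V * (T - F) * V + star V * F * V := by
      rw [← add_mul, ← mul_add, sub_add_cancel]
    rw [e1, hL_add _ _ (mem_conj hV hR) (mem_conj hV (mem_rank hFr)), add_sub_cancel_right]
    have h0 : 0 ≤ schattenNorm 1 (star V * (T - F) * V) := by
      rw [norm_eq]; exact tsum_nonneg fun n => sv_nonneg _ _
    calc _ ≤ M * schattenNorm 1 (star V * (T - F) * V) := hM _ (mem_conj hV hR)
      _ ≤ |M| * schattenNorm 1 (star V * (T - F) * V) := by gcongr; exact le_abs_self M
      _ ≤ |M| * η := by gcongr; exact (schatten_conj hV hR).trans h1.le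
  have hLF : ∀ V : H →L[ℂ] H, L (star V * F * V) = ∑ i, ⟪A (star V (u i)), star V (v i)⟫_ℂ := by
    intro V
    rw [hF, conj_sum, L_sum L hL_add hL_smul]
    simp only [hA]
  obtain ⟨W, hW, hWe⟩ := main_fin A hf hfw t ht0 ht1 (fun i => star U (u i))
    (fun i => star U (v i)) (ε / 2) (by positivity)
  have hV : U * star W ∈ unitary (H →L[ℂ] H) := mul_mem hU (Unitary.star_mem hW)
  refine ⟨U * star W, hV, ?_⟩
  have hin : ∀ x y, ⟪star U x, star U y⟫_ℂ = ⟪x, y⟫_ℂ := by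
    intro x y
    conv_lhs => rw [ContinuousLinearMap.star_eq_adjoint, ContinuousLinearMap.adjoint_inner_left,
      ← ContinuousLinearMap.star_eq_adjoint, ← mul_apply_eq_comp, (Unitary.mem_iff.1 hU).2]
    rfl
  have e2 : L (star (U * star W) * F * (U * star W)) =
      ∑ i, ⟪A (W (star U (u i))), W (star U (v i))⟫_ℂ := by
    rw [hLF]
    simp only [star_mul, star_star, mul_apply_eq_comp]
  simp only [hin] at hWe
  rw [← e2, ← hLF U] at hWe
  have h3 := hLR _ hV
  have h4 := hLR U hU
  set X := L (star (U * star W) * T * (U * star W))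
  set X' := L (star (U * star W) * F * (U * star W))
  set Y := L (star U * T * U)
  set Y' := L (star U * F * U)
  set τ := traceAlong b T
  set τ' := ∑ i, ⟪u i, v i⟫_ℂ
  have key : X - (t * (τ * w) + (1 - (t:ℂ)) * Y) =
      (X - X') + (X' - (t * (τ' * w) + (1 - (t:ℂ)) * Y'))
        - ((t:ℂ) * ((τ - τ') * w) + ((1 - t : ℝ) : ℂ) * (Y - Y')) := by
    push_cast; ring
  rw [key]
  have n1 : ‖(t:ℂ) * ((τ - τ') * w)‖ ≤ η * ‖w‖ := by
    rw [norm_mul, norm_mul, Complex.norm_real, Real.norm_of_nonneg ht0]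
    calc _ ≤ 1 * (η * ‖w‖) := by gcongr
      _ = _ := one_mul _
  have n2 : ‖((1 - t : ℝ) : ℂ) * (Y - Y')‖ ≤ |M| * η := by
    rw [norm_mul, Complex.norm_real, Real.norm_of_nonneg (by linarith)]
    calc _ ≤ 1 * (|M| * η) := by gcongr; linarith
      _ = _ := one_mul _
  have n3 := norm_sub_le ((X - X') + (X' - (t * (τ' * w) + (1 - (t:ℂ)) * Y')))
    ((t:ℂ) * ((τ - τ') * w) + ((1 - t : ℝ) : ℂ) * (Y - Y'))
  have n4 := norm_add_le (X - X') (X' - (t * (τ' * w) + (1 - (t:ℂ)) * Y'))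
  have n5 := norm_add_le ((t:ℂ) * ((τ - τ') * w)) (((1 - t : ℝ) : ℂ) * (Y - Y'))
  have n6 : |M| * η + η * ‖w‖ + |M| * η ≤ ε / 2 := by
    rw [← hηC, hC]; nlinarith
  linarith

end

end St13

/-- Let `T ∈ B^1(H)` be trace class and let `L` be a bounded linear
functional on `B^1(H)` (encoded as a function which is additive, homogeneous and
`ν_1`-bounded on the trace class).  Then for every `z ∈ tr(T)·W_e(L)`, the closure of
`L(O_U(T)) = { L(U† T U) | U unitary }` is star-shaped with respect to `z`. -/
theorem stmt_13 {H : Type*} [NormedAddCommGroup H] [InnerProductSpace ℂ H] [CompleteSpace H]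
    (b : HilbertBasis ℕ ℂ H)  -- `H` is infinite-dimensional and separable
    (T : H →L[ℂ] H) (hT : MemSchatten 1 T)
    (L : (H →L[ℂ] H) → ℂ)
    (hL_add : ∀ A B, MemSchatten 1 A → MemSchatten 1 B → L (A + B) = L A + L B)
    (hL_smul : ∀ (c : ℂ) A, MemSchatten 1 A → L (c • A) = c * L A)
    (hL_bdd : ∃ M : ℝ, ∀ A, MemSchatten 1 A → ‖L A‖ ≤ M * schattenNorm 1 A)
    (z : ℂ) (hz : z ∈ (fun w => traceAlong b T * w) '' essRange L) :
    z ∈ closure {z' | ∃ U ∈ unitary (H →L[ℂ] H), z' = L (star U * T * U)} ∧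
      StarConvex ℝ z
        (closure {z' | ∃ U ∈ unitary (H →L[ℂ] H), z' = L (star U * T * U)}) := by
  obtain ⟨w, hw, rfl⟩ := hz
  have key := St13.main_approx b T hT L hL_add hL_smul hL_bdd w hw
  set S : Set ℂ := {z' | ∃ U ∈ unitary (H →L[ℂ] H), z' = L (star U * T * U)} with hS
  have hseg : ∀ y ∈ S, ∀ t : ℝ, 0 ≤ t → t ≤ 1 →
      (t : ℂ) * (traceAlong b T * w) + (1 - (t : ℂ)) * y ∈ closure S := by
    rintro y ⟨U, hU, rfl⟩ t ht0 ht1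
    rw [Metric.mem_closure_iff]
    intro ε hε
    obtain ⟨V, hV, h⟩ := key U hU t ht0 ht1 ε hε
    refine ⟨_, ⟨V, hV, rfl⟩, ?_⟩
    rw [dist_comm, dist_eq_norm]
    exact h
  refine ⟨?_, ?_⟩
  · have := hseg _ ⟨1, one_mem _, rfl⟩ 1 zero_le_one le_rfl
    simpa using this
  · intro y hy p q hp hq hpq
    obtain rfl : q = 1 - p := by linarith
    have hcont : Continuous fun y : ℂ => (p : ℂ) * (traceAlong b T * w) + (1 - (p : ℂ)) * y := by
      fun_prop
    have hm : Set.MapsTo (fun y : ℂ => (p : ℂ) * (traceAlong b T * w) + (1 - (p : ℂ)) * y)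
        S (closure S) := fun y hy => hseg y hy p hp (by linarith)
    have := hm.closure hcont hy
    rw [closure_closure] at this
    simpa [Complex.real_smul] using this
end
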